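/- Let G = (μ, X, Y, A, B, V) be a two-player one-round game whose question distribution is a product distribution, μ = μ_X ⊗ μ_Y, and suppose |A|·|B| ≥ 2. Let ε ∈ (0,1] and suppose the entangled value satisfies ω*(G) ≤ 1 − ε. Then for every integer k ≥ 1, the entangled value of the k-fold product game satisfies ω*(G^k) ≤ (1 − ε/2)^{ε²·k / (12000·(log₂|A| + log₂|B|))}. -/

import Mathlib

open Matrix Kronecker
open scoped ComplexOrder

noncomputable section

/-- A two-player one-round game: a question distribution `μ` on `X × Y` and a
predicate `V` on questions and answers. (The requirement that `μ` is a genuine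
probability distribution is stated as a hypothesis in the theorems.) -/
structure Game (X Y A B : Type) where
  μ : X × Y → ℝ
  V : X → Y → A → B → Bool

/-- The winning probability of an entangled strategy, given by a shared unit vector
`ψ` on `ℂ^{dA} ⊗ ℂ^{dB}` and POVMs `{Al x a}_a` for Alice and `{Bo y b}_b` for Bob. -/
noncomputable def winProb {X Y A B : Type}
    [Fintype X] [Fintype Y] [Fintype A] [Fintype B] (G : Game X Y A B)
    {dA dB : ℕ} (ψ : Fin dA × Fin dB → ℂ)
    (Al : X → A → Matrix (Fin dA) (Fin dA) ℂ)
    (Bo : Y → B → Matrix (Fin dB) (Fin dB) ℂ) : ℝ :=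
  ∑ x : X, ∑ y : Y, ∑ a : A, ∑ b : B,
    G.μ (x, y) * (if G.V x y a b then 1 else 0) *
      (star ψ ⬝ᵥ ((Al x a ⊗ₖ Bo y b) *ᵥ ψ)).re

/-- The entangled value `ω*(G)`: the supremum of winning probabilities over all
entangled strategies (finite-dimensional shared entanglement and POVMs). -/
noncomputable def entangledValue {X Y A B : Type}
    [Fintype X] [Fintype Y] [Fintype A] [Fintype B] (G : Game X Y A B) : ℝ :=
  sSup { p : ℝ | ∃ (dA dB : ℕ) (ψ : Fin dA × Fin dB → ℂ)
    (Al : X → A → Matrix (Fin dA) (Fin dA) ℂ)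
    (Bo : Y → B → Matrix (Fin dB) (Fin dB) ℂ),
    star ψ ⬝ᵥ ψ = 1 ∧
    (∀ x a, (Al x a).PosSemidef) ∧ (∀ x, ∑ a : A, Al x a = 1) ∧
    (∀ y b, (Bo y b).PosSemidef) ∧ (∀ y, ∑ b : B, Bo y b = 1) ∧
    p = winProb G ψ Al Bo }

/-- The `k`-fold product game `G^k`. -/
def gamePow {X Y A B : Type} (G : Game X Y A B) (k : ℕ) :
    Game (Fin k → X) (Fin k → Y) (Fin k → A) (Fin k → B) where
  μ := fun p => ∏ i, G.μ (p.1 i, p.2 i)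
  V := fun x y a b => decide (∀ i, G.V (x i) (y i) (a i) (b i) = true)


/-! ### Functional calculus for Hermitian matrices -/

section MatrixFun

set_option linter.unusedSectionVars false
set_option linter.unusedVariables false

variable {n : Type} [Fintype n] [DecidableEq n]

/-- real part of the trace -/
def rt (A : Matrix n n ℂ) : ℝ := A.trace.re

lemma rt_add (A B : Matrix n n ℂ) : rt (A + B) = rt A + rt B := by simp [rt]
lemma rt_sub (A B : Matrix n n ℂ) : rt (A - B) = rt A - rt B := by simp [rt]
lemma rt_smul (c : ℝ) (A : Matrix n n ℂ) : rt (c • A) = c * rt A := by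
  simp [rt, Matrix.trace_smul]
lemma rt_sum {ι : Type*} (s : Finset ι) (f : ι → Matrix n n ℂ) :
    rt (∑ i ∈ s, f i) = ∑ i ∈ s, rt (f i) := by
  simp [rt, Matrix.trace_sum]
lemma rt_mul_comm (A B : Matrix n n ℂ) : rt (A * B) = rt (B * A) := by
  simp [rt, Matrix.trace_mul_comm A B]
lemma rt_conjTranspose (A : Matrix n n ℂ) : rt Aᴴ = rt A := by
  simp [rt, Matrix.trace_conjTranspose]
lemma rt_nonneg {A : Matrix n n ℂ} (h : A.PosSemidef) : 0 ≤ rt A := by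
  have := h.trace_nonneg
  exact (Complex.le_def.1 this).1
lemma rt_conj_mul (A : Matrix n n ℂ) : rt (Aᴴ * A) = ∑ i, ∑ j, ‖A j i‖ ^ 2 := by
  simp only [rt, Matrix.trace, Matrix.diag, Matrix.mul_apply, Complex.re_sum,
    Matrix.conjTranspose_apply]
  refine Finset.sum_congr rfl fun i _ => Finset.sum_congr rfl fun j _ => ?_
  rw [← Complex.normSq_eq_norm_sq, Complex.star_def, ← Complex.normSq_eq_conj_mul_self]
  simp

open Classical in
/-- eigenvector unitary -/
def eU (A : Matrix n n ℂ) : Matrix n n ℂ :=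
  if h : A.IsHermitian then (h.eigenvectorUnitary : Matrix n n ℂ) else 1

open Classical in
/-- eigenvalues -/
def eV (A : Matrix n n ℂ) : n → ℝ :=
  if h : A.IsHermitian then h.eigenvalues else 0

lemma eU_left (A : Matrix n n ℂ) : (eU A)ᴴ * eU A = 1 := by
  unfold eU
  split_ifs with h
  · exact Unitary.coe_star_mul_self h.eigenvectorUnitary
  · simp

lemma eU_right (A : Matrix n n ℂ) : eU A * (eU A)ᴴ = 1 :=
  mul_eq_one_comm.1 (eU_left A)

/-- functional calculus -/
def mfun (f : ℝ → ℝ) (A : Matrix n n ℂ) : Matrix n n ℂ :=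
  eU A * diagonal (fun i => ((f (eV A i) : ℝ) : ℂ)) * (eU A)ᴴ

lemma mfun_id {A : Matrix n n ℂ} (h : A.IsHermitian) : mfun (fun x => x) A = A := by
  conv_rhs => rw [h.spectral_theorem]
  simp only [mfun, eU, eV, h, dif_pos, Unitary.conjStarAlgAut_apply]
  rfl

lemma mfun_mul (f g : ℝ → ℝ) (A : Matrix n n ℂ) :
    mfun f A * mfun g A = mfun (fun x => f x * g x) A := by
  unfold mfun
  have : eU A * diagonal (fun i => ((f (eV A i) : ℝ) : ℂ)) * (eU A)ᴴ *
      (eU A * diagonal (fun i => ((g (eV A i) : ℝ) : ℂ)) * (eU A)ᴴ) =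
      eU A * (diagonal (fun i => ((f (eV A i) : ℝ) : ℂ)) * ((eU A)ᴴ * eU A) *
       diagonal (fun i => ((g (eV A i) : ℝ) : ℂ))) * (eU A)ᴴ := by
    simp only [mul_assoc]
  rw [this, eU_left, mul_one, diagonal_mul_diagonal]
  simp

lemma mfun_congr {f g : ℝ → ℝ} {A : Matrix n n ℂ} (h : ∀ i, f (eV A i) = g (eV A i)) :
    mfun f A = mfun g A := by
  unfold mfun; simp [h]

lemma mfun_herm (f : ℝ → ℝ) (A : Matrix n n ℂ) : (mfun f A)ᴴ = mfun f A := by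
  unfold mfun
  simp only [conjTranspose_mul, conjTranspose_conjTranspose, diagonal_conjTranspose, mul_assoc]
  congr 2
  · ext i j
    simp [diagonal]

lemma eV_pos {A : Matrix n n ℂ} (h : A.PosDef) (i : n) : 0 < eV A i := by
  simp only [eV, h.1, dif_pos]
  exact h.eigenvalues_pos i

lemma eV_nonneg {A : Matrix n n ℂ} (h : A.PosSemidef) (i : n) : 0 ≤ eV A i := by
  simp only [eV, h.1, dif_pos]
  exact h.eigenvalues_nonneg i

/-- square root -/
def msqrt (A : Matrix n n ℂ) : Matrix n n ℂ := mfun Real.sqrt A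

lemma msqrt_mul_psd {A : Matrix n n ℂ} (h : A.PosSemidef) : msqrt A * msqrt A = A := by
  unfold msqrt
  rw [mfun_mul]
  conv_rhs => rw [← mfun_id h.1]
  exact mfun_congr fun i => Real.mul_self_sqrt (eV_nonneg h i)

lemma msqrt_mul {A : Matrix n n ℂ} (h : A.PosDef) : msqrt A * msqrt A = A :=
  msqrt_mul_psd h.posSemidef

lemma msqrt_herm (A : Matrix n n ℂ) : (msqrt A)ᴴ = msqrt A := mfun_herm _ _

lemma rt_mul_nonneg {A B : Matrix n n ℂ} (hA : A.PosSemidef) (hB : B.PosSemidef) :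
    0 ≤ rt (A * B) := by
  rw [← msqrt_mul_psd hB, ← mul_assoc, rt_mul_comm, ← mul_assoc]
  have := hA.mul_mul_conjTranspose_same (msqrt B)
  rw [msqrt_herm] at this
  exact rt_nonneg this

lemma msqrt_isUnit {A : Matrix n n ℂ} (h : A.PosDef) : IsUnit (msqrt A) := by
  have h1 : IsUnit (msqrt A * msqrt A) := by rw [msqrt_mul h]; exact h.isUnit
  exact isUnit_of_mul_isUnit_left h1

/-- overlaps of eigenvectors -/
def ov (A B : Matrix n n ℂ) : Matrix n n ℂ := (eU A)ᴴ * eU B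

/-- squared overlaps -/
def ow (A B : Matrix n n ℂ) (i j : n) : ℝ := ‖ov A B i j‖ ^ 2

lemma ow_nonneg (A B : Matrix n n ℂ) (i j : n) : 0 ≤ ow A B i j := by unfold ow; positivity

lemma rt_mfun_mul (f g : ℝ → ℝ) (A B : Matrix n n ℂ) :
    rt (mfun f A * mfun g B) = ∑ i, ∑ j, ow A B i j * (f (eV A i) * g (eV B j)) := by
  have h1 : rt (mfun f A * mfun g B) = rt (diagonal (fun i => ((f (eV A i) : ℝ) : ℂ)) * ov A B *
      (diagonal (fun i => ((g (eV B i) : ℝ) : ℂ)) * (ov A B)ᴴ)) := by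
    unfold mfun ov
    rw [mul_assoc (eU A), mul_assoc (eU A), rt_mul_comm]
    simp only [conjTranspose_mul, conjTranspose_conjTranspose, mul_assoc]
  rw [h1]
  simp only [rt, Matrix.trace, Matrix.diag, Matrix.mul_apply (M := diagonal _ * ov A B),
    Complex.re_sum, diagonal_mul, conjTranspose_apply]
  refine Finset.sum_congr rfl fun i _ => Finset.sum_congr rfl fun j _ => ?_
  unfold ow
  rw [← Complex.normSq_eq_norm_sq]
  have : (f (eV A i) : ℂ) * ov A B i j * ((g (eV B j) : ℂ) * star (ov A B i j)) =
      ((Complex.normSq (ov A B i j) * (f (eV A i) * g (eV B j)) : ℝ) : ℂ) := by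
    push_cast
    rw [Complex.normSq_eq_conj_mul_self, Complex.star_def]; ring
  rw [this, Complex.ofReal_re]

lemma mfun_one (A : Matrix n n ℂ) : mfun (fun _ => 1) A = 1 := by
  unfold mfun
  simp [eU_right]

/-- matrix logarithm -/
def mlog (A : Matrix n n ℂ) : Matrix n n ℂ := mfun Real.log A

/-- relative entropy -/
def relEnt (A B : Matrix n n ℂ) : ℝ := rt (A * mlog A) - rt (A * mlog B)

lemma rt_mul_mfun {A B : Matrix n n ℂ} (hA : A.IsHermitian) (g : ℝ → ℝ) :
    rt (A * mfun g B) = ∑ i, ∑ j, ow A B i j * (eV A i * g (eV B j)) := by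
  have := rt_mfun_mul (fun x => x) g A B
  rwa [mfun_id hA] at this

lemma rt_mfun_left {A B : Matrix n n ℂ} (hA : A.IsHermitian) (f : ℝ → ℝ) :
    rt (mfun f A) = ∑ i, ∑ j, ow A B i j * f (eV A i) := by
  have := rt_mfun_mul f (fun _ => 1) A B
  simpa [mfun_one] using this

lemma rt_mfun_right {A B : Matrix n n ℂ} (hB : B.IsHermitian) (f : ℝ → ℝ) :
    rt (mfun f B) = ∑ i, ∑ j, ow A B i j * f (eV B j) := by
  have := rt_mfun_mul (fun _ => 1) f A B
  simpa [mfun_one] using this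

lemma relEnt_eq {A B : Matrix n n ℂ} (hA : A.IsHermitian) :
    relEnt A B = ∑ i, ∑ j, ow A B i j *
      (eV A i * Real.log (eV A i) - eV A i * Real.log (eV B j)) := by
  unfold relEnt mlog
  have h0 : A * mfun Real.log A = mfun (fun x => x * Real.log x) A := by
    have := mfun_mul (fun x => x) Real.log A
    rwa [mfun_id hA] at this
  rw [h0, rt_mul_mfun hA, rt_mfun_left (B := B) hA, ← Finset.sum_sub_distrib]
  refine Finset.sum_congr rfl fun i _ => ?_
  rw [← Finset.sum_sub_distrib]
  exact Finset.sum_congr rfl fun j _ => by ring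

lemma relEnt_self (A : Matrix n n ℂ) : relEnt A A = 0 := by simp [relEnt]

/-- relative entropy dominates the Hellinger distance -/
lemma hellinger_le {A B : Matrix n n ℂ} (hA : A.PosDef) (hB : B.PosDef) :
    rt ((msqrt A - msqrt B)ᴴ * (msqrt A - msqrt B)) ≤ relEnt A B + rt B - rt A := by
  have h1 : (msqrt A - msqrt B)ᴴ * (msqrt A - msqrt B) =
      A + B - msqrt A * msqrt B - msqrt B * msqrt A := by
    rw [conjTranspose_sub, msqrt_herm, msqrt_herm, sub_mul, mul_sub, mul_sub, msqrt_mul hA,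
      msqrt_mul hB]
    abel
  rw [h1, rt_sub, rt_sub, rt_add, rt_mul_comm (msqrt B)]
  have h2 : rt (msqrt A * msqrt B) = ∑ i, ∑ j, ow A B i j * (√(eV A i) * √(eV B j)) :=
    rt_mfun_mul _ _ _ _
  have h3 : rt A = ∑ i, ∑ j, ow A B i j * eV A i := by
    have := rt_mfun_left (B := B) hA.1 (fun x => x)
    rwa [mfun_id hA.1] at this
  have h4 : 2 * rt A ≤ relEnt A B + 2 * rt (msqrt A * msqrt B) := by
    rw [relEnt_eq hA.1, h2, h3, Finset.mul_sum, Finset.mul_sum, ← Finset.sum_add_distrib]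
    refine Finset.sum_le_sum fun i _ => ?_
    rw [Finset.mul_sum, Finset.mul_sum, ← Finset.sum_add_distrib]
    refine Finset.sum_le_sum fun j _ => ?_
    have ha := eV_pos hA i
    have hb := eV_pos hB j
    have hw := ow_nonneg A B i j
    generalize eV A i = a at *
    generalize eV B j = b at *
    have key : 2 * a ≤ a * Real.log a - a * Real.log b + 2 * (√a * √b) := by
      have hs : 0 < √b / √a := div_pos (Real.sqrt_pos.2 hb) (Real.sqrt_pos.2 ha)
      have := Real.log_le_sub_one_of_pos hs
      rw [Real.log_div (Real.sqrt_pos.2 hb).ne' (Real.sqrt_pos.2 ha).ne', Real.log_sqrt hb.le,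
        Real.log_sqrt ha.le] at this
      have h5 : a * (√b / √a) = √a * √b := by
        have : a = √a * √a := (Real.mul_self_sqrt ha.le).symm
        have h0 := (Real.sqrt_pos.2 ha).ne'
        field_simp
        nlinarith
      nlinarith
    nlinarith
  linarith

/-- Klein inequality with normalisation -/
lemma klein {A B : Matrix n n ℂ} (hA : A.PosDef) (hB : B.PosDef) (hn : 0 < rt A) (hm : 0 < rt B) :
    - relEnt A B ≤ rt A * Real.log (rt B / rt A) := by
  have h3 : rt A = ∑ i, ∑ j, ow A B i j * eV A i := by
    have := rt_mfun_left (B := B) hA.1 (fun x => x)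
    rwa [mfun_id hA.1] at this
  have h4 : rt B = ∑ i, ∑ j, ow A B i j * eV B j := by
    have := rt_mfun_right (A := A) hB.1 (fun x => x)
    rwa [mfun_id hB.1] at this
  have key : ∀ c : ℝ, 0 < c → rt A * (Real.log c + 1) - c * rt B ≤ relEnt A B := by
    intro c hc
    rw [relEnt_eq hA.1, h3, h4, Finset.sum_mul, Finset.mul_sum, ← Finset.sum_sub_distrib]
    refine Finset.sum_le_sum fun i _ => ?_
    rw [Finset.sum_mul, Finset.mul_sum, ← Finset.sum_sub_distrib]
    refine Finset.sum_le_sum fun j _ => ?_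
    have ha := eV_pos hA i
    have hb := eV_pos hB j
    have hw := ow_nonneg A B i j
    generalize eV A i = a at *
    generalize eV B j = b at *
    have key : a * (Real.log c + 1) - c * b ≤ a * Real.log a - a * Real.log b := by
      have := Real.log_le_sub_one_of_pos (show 0 < c * b / a by positivity)
      rw [Real.log_div (by positivity) ha.ne', Real.log_mul hc.ne' hb.ne'] at this
      have h5 : a * (c * b / a) = c * b := by field_simp
      nlinarith
    nlinarith
  have := key (rt A / rt B) (by positivity)
  rw [Real.log_div hn.ne' hm.ne', div_mul_cancel₀ _ hm.ne'] at this
  rw [Real.log_div hm.ne' hn.ne']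
  linarith

end MatrixFun

/-! ### Joint convexity of the relative entropy -/

section JointConvexity

set_option linter.unusedSectionVars false
set_option linter.unusedVariables false

variable {n : Type} [Fintype n] [DecidableEq n]

/-- integrand in the integral representation of the relative entropy -/
def Qs (s : ℝ) (A B : Matrix n n ℂ) : ℝ :=
  ∑ i, ∑ j, ow A B i j * (eV A i ^ 2 / (eV B j + s * eV A i))

/-- the linear functional whose supremum over `k` is `Qs` -/
def linQ (s : ℝ) (k A B : Matrix n n ℂ) : ℝ :=
  2 * rt (kᴴ * A) - s * rt (kᴴ * A * k) - rt (kᴴ * k * B)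

lemma rt_conj_diag (m u : Matrix n n ℂ) (a b : n → ℝ) :
    rt (mᴴ * diagonal (fun i => (a i : ℂ)) * u * diagonal (fun i => (b i : ℂ))) =
      ∑ i, ∑ j, a i * b j * (star (m i j) * u i j).re := by
  simp only [rt, Matrix.trace, Matrix.diag, Complex.re_sum, mul_diagonal,
    Matrix.mul_apply (M := mᴴ * diagonal _), conjTranspose_apply, Finset.sum_mul]
  rw [Finset.sum_comm]
  refine Finset.sum_congr rfl fun i _ => Finset.sum_congr rfl fun j _ => ?_
  have : star (m i j) * (a i : ℂ) * u i j * (b j : ℂ) =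
    ((a i * b j : ℝ) : ℂ) * (star (m i j) * u i j) := by push_cast; ring
  rw [this, Complex.re_ofReal_mul]

lemma conj_aux (U W m D E : Matrix n n ℂ) (hUU : Uᴴ * U = 1) (hWW : Wᴴ * W = 1) :
    rt ((U * m * Wᴴ)ᴴ * (U * D * Uᴴ)) = rt (mᴴ * D * (Uᴴ * W) * 1) ∧
    rt ((U * m * Wᴴ)ᴴ * (U * D * Uᴴ) * (U * m * Wᴴ)) = rt (mᴴ * D * m * 1) ∧
    rt ((U * m * Wᴴ)ᴴ * (U * m * Wᴴ) * (W * E * Wᴴ)) = rt (mᴴ * 1 * m * E) := by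
  have hUU' : ∀ M, Uᴴ * (U * M) = M := fun M => by rw [← mul_assoc, hUU, one_mul]
  have hWW' : ∀ M, Wᴴ * (W * M) = M := fun M => by rw [← mul_assoc, hWW, one_mul]
  refine ⟨?_, ?_, ?_⟩
  · rw [conjTranspose_mul, conjTranspose_mul, conjTranspose_conjTranspose]
    simp only [mul_assoc, hUU']
    rw [rt_mul_comm]
    simp only [mul_assoc, mul_one]
  · rw [conjTranspose_mul, conjTranspose_mul, conjTranspose_conjTranspose]
    simp only [mul_assoc, hUU']
    rw [rt_mul_comm]
    simp only [mul_assoc, hWW, mul_one]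
  · rw [conjTranspose_mul, conjTranspose_mul, conjTranspose_conjTranspose]
    simp only [mul_assoc, hUU', hWW']
    rw [rt_mul_comm]
    simp only [mul_assoc, hWW, mul_one, one_mul]

lemma linQ_eq (s : ℝ) (m : Matrix n n ℂ) {A B : Matrix n n ℂ} (hA : A.IsHermitian)
    (hB : B.IsHermitian) :
    linQ s (eU A * m * (eU B)ᴴ) A B = ∑ i, ∑ j,
      (2 * eV A i * (star (m i j) * ov A B i j).re - (s * eV A i + eV B j) * ‖m i j‖ ^ 2) := by
  have eA : eU A * diagonal (fun i => ((eV A i : ℝ) : ℂ)) * (eU A)ᴴ = A := mfun_id hA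
  have eB : eU B * diagonal (fun i => ((eV B i : ℝ) : ℂ)) * (eU B)ᴴ = B := mfun_id hB
  have one_diag : (1 : Matrix n n ℂ) = diagonal (fun i => (((fun _ => 1 : n → ℝ) i : ℝ) : ℂ)) := by
    simp
  obtain ⟨h1, h2, h3⟩ := conj_aux (eU A) (eU B) m (diagonal (fun i => ((eV A i : ℝ) : ℂ)))
    (diagonal (fun i => ((eV B i : ℝ) : ℂ))) (eU_left A) (eU_left B)
  rw [eA] at h1 h2
  rw [eB] at h3
  unfold linQ
  rw [h1, h2, h3, one_diag, rt_conj_diag, rt_conj_diag, rt_conj_diag]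
  rw [Finset.mul_sum, Finset.mul_sum, ← Finset.sum_sub_distrib, ← Finset.sum_sub_distrib]
  refine Finset.sum_congr rfl fun i _ => ?_
  rw [Finset.mul_sum, Finset.mul_sum, ← Finset.sum_sub_distrib, ← Finset.sum_sub_distrib]
  refine Finset.sum_congr rfl fun j _ => ?_
  have : (star (m i j) * m i j).re = ‖m i j‖ ^ 2 := by
    rw [← Complex.normSq_eq_norm_sq, Complex.star_def, ← Complex.normSq_eq_conj_mul_self]
    simp
  rw [this, ov]
  ring

lemma linQ_le {s : ℝ} (hs : 0 ≤ s) (k : Matrix n n ℂ) {A B : Matrix n n ℂ} (hA : A.PosDef)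
    (hB : B.PosDef) : linQ s k A B ≤ Qs s A B := by
  have hk : k = eU A * ((eU A)ᴴ * k * eU B) * (eU B)ᴴ := by
    have : eU A * ((eU A)ᴴ * k * eU B) * (eU B)ᴴ = (eU A * (eU A)ᴴ) * k * (eU B * (eU B)ᴴ) := by
      simp only [mul_assoc]
    rw [this, eU_right, eU_right, one_mul, mul_one]
  rw [hk, linQ_eq s _ hA.1 hB.1, Qs]
  refine Finset.sum_le_sum fun i _ => Finset.sum_le_sum fun j _ => ?_
  have ha := eV_pos hA i
  have hb := eV_pos hB j
  unfold ow
  generalize eV A i = a at *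
  generalize eV B j = b at *
  generalize ((eU A)ᴴ * k * eU B) i j = m
  generalize ov A B i j = u
  have h1 : (star m * u).re ≤ ‖m‖ * ‖u‖ := by
    calc (star m * u).re ≤ ‖star m * u‖ := Complex.re_le_norm _
      _ = ‖m‖ * ‖u‖ := by rw [norm_mul, norm_star]
  have hc : 0 < b + s * a := by positivity
  rw [← mul_div_assoc, le_div_iff₀ hc]
  have h2 : a * (star m * u).re ≤ a * (‖m‖ * ‖u‖) := mul_le_mul_of_nonneg_left h1 ha.le
  have h3 : (2 * a * (star m * u).re - (s * a + b) * ‖m‖ ^ 2) * (b + s * a) ≤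
      (2 * (a * (‖m‖ * ‖u‖)) - (s * a + b) * ‖m‖ ^ 2) * (b + s * a) := by
    apply mul_le_mul_of_nonneg_right _ hc.le
    linarith
  nlinarith [sq_nonneg (a * ‖u‖ - (b + s * a) * ‖m‖)]

lemma linQ_attain {s : ℝ} (hs : 0 ≤ s) {A B : Matrix n n ℂ} (hA : A.PosDef)
    (hB : B.PosDef) : ∃ k, linQ s k A B = Qs s A B := by
  refine ⟨eU A * (Matrix.of fun i j =>
    (((eV A i / (eV B j + s * eV A i) : ℝ)) : ℂ) * ov A B i j) * (eU B)ᴴ, ?_⟩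
  rw [linQ_eq s _ hA.1 hB.1, Qs]
  refine Finset.sum_congr rfl fun i _ => Finset.sum_congr rfl fun j _ => ?_
  have ha := eV_pos hA i
  have hb := eV_pos hB j
  unfold ow
  simp only [of_apply]
  generalize eV A i = a at *
  generalize eV B j = b at *
  generalize ov A B i j = u
  have hc : 0 < b + s * a := by positivity
  have h1 : (star (((a / (b + s * a) : ℝ) : ℂ) * u) * u).re = a / (b + s * a) * ‖u‖ ^ 2 := by
    have : star (((a / (b + s * a) : ℝ) : ℂ) * u) * u =
        ((a / (b + s * a) * Complex.normSq u : ℝ) : ℂ) := by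
      rw [Complex.star_def, map_mul, Complex.conj_ofReal, Complex.ofReal_mul,
        Complex.normSq_eq_conj_mul_self]; ring
    rw [this, Complex.ofReal_re, Complex.normSq_eq_norm_sq]
  rw [h1, norm_mul, Complex.norm_real, mul_pow, Real.norm_eq_abs, sq_abs]
  field_simp
  ring

lemma linQ_sum {ι : Type*} (t : Finset ι) (w : ι → ℝ) (s : ℝ) (k : Matrix n n ℂ)
    (A B : ι → Matrix n n ℂ) :
    linQ s k (∑ l ∈ t, w l • A l) (∑ l ∈ t, w l • B l) = ∑ l ∈ t, w l * linQ s k (A l) (B l) := by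
  simp only [linQ, Matrix.sum_mul, rt_sum, mul_smul_comm, smul_mul_assoc, rt_smul,
    Finset.mul_sum]
  rw [← Finset.sum_sub_distrib, ← Finset.sum_sub_distrib]
  exact Finset.sum_congr rfl fun l _ => by ring

lemma Qs_convex {ι : Type*} (t : Finset ι) (w : ι → ℝ) (hw : ∀ l, 0 ≤ w l) {s : ℝ} (hs : 0 ≤ s)
    (A B : ι → Matrix n n ℂ) (hA : ∀ l, (A l).PosDef) (hB : ∀ l, (B l).PosDef)
    (hA' : (∑ l ∈ t, w l • A l).PosDef) (hB' : (∑ l ∈ t, w l • B l).PosDef) :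
    Qs s (∑ l ∈ t, w l • A l) (∑ l ∈ t, w l • B l) ≤ ∑ l ∈ t, w l * Qs s (A l) (B l) := by
  obtain ⟨k, hk⟩ := linQ_attain hs hA' hB'
  rw [← hk, linQ_sum]
  exact Finset.sum_le_sum fun l _ =>
    mul_le_mul_of_nonneg_left (linQ_le hs k (hA l) (hB l)) (hw l)

lemma Qs_anti {s : ℝ} (hs : 0 ≤ s) {A B B' : Matrix n n ℂ} (hA : A.PosDef) (hB : B.PosDef)
    (hB' : B'.PosDef) (h : (B' - B).PosSemidef) : Qs s A B' ≤ Qs s A B := by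
  obtain ⟨k, hk⟩ := linQ_attain hs hA hB'
  rw [← hk]
  refine le_trans ?_ (linQ_le hs k hA hB)
  have := rt_mul_nonneg (posSemidef_conjTranspose_mul_self k) h
  rw [mul_sub, rt_sub] at this
  unfold linQ
  linarith

/-- antiderivative of `Qs` -/
def IT (T : ℝ) (A B : Matrix n n ℂ) : ℝ :=
  ∑ i, ∑ j, ow A B i j * (eV A i * (Real.log (eV B j + T * eV A i) - Real.log (eV B j)))

lemma IT_zero (A B : Matrix n n ℂ) : IT 0 A B = 0 := by simp [IT]

lemma IT_deriv {A B : Matrix n n ℂ} (hA : A.PosDef) (hB : B.PosDef) {T : ℝ} (hT : 0 ≤ T) :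
    HasDerivAt (fun T => IT T A B) (Qs T A B) T := by
  unfold IT Qs
  refine HasDerivAt.fun_sum fun i _ => HasDerivAt.fun_sum fun j _ => ?_
  have ha := eV_pos hA i
  have hb := eV_pos hB j
  refine HasDerivAt.const_mul _ ?_
  have h1 : HasDerivAt (fun T => eV B j + T * eV A i) (eV A i) T := by
    simpa using ((hasDerivAt_id T).mul_const (eV A i)).const_add (eV B j)
  have h2 := ((h1.log (by positivity)).sub_const (Real.log (eV B j))).const_mul (eV A i)
  convert h2 using 1
  ring

lemma IT_tendsto {A B : Matrix n n ℂ} (hA : A.PosDef) (hB : B.PosDef) :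
    Filter.Tendsto (fun T => IT T A B - rt A * Real.log T) Filter.atTop
      (nhds (relEnt A B)) := by
  have h3 : rt A = ∑ i, ∑ j, ow A B i j * eV A i := by
    have := rt_mfun_left (B := B) hA.1 (fun x => x)
    rwa [mfun_id hA.1] at this
  have h4 : ∀ T, IT T A B - rt A * Real.log T = ∑ i, ∑ j, ow A B i j *
      (eV A i * (Real.log (eV B j + T * eV A i) - Real.log T) - eV A i * Real.log (eV B j)) := by
    intro T
    rw [IT, h3, Finset.sum_mul, ← Finset.sum_sub_distrib]
    refine Finset.sum_congr rfl fun i _ => ?_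
    rw [Finset.sum_mul, ← Finset.sum_sub_distrib]
    exact Finset.sum_congr rfl fun j _ => by ring
  simp only [h4]
  rw [relEnt_eq hA.1]
  refine tendsto_finsetSum _ fun i _ => tendsto_finsetSum _ fun j _ => ?_
  have ha := eV_pos hA i
  have hb := eV_pos hB j
  refine Filter.Tendsto.const_mul _ (Filter.Tendsto.sub_const (Filter.Tendsto.const_mul _ ?_) _)
  have h5 : Filter.Tendsto (fun T : ℝ => Real.log (eV B j * T⁻¹ + eV A i)) Filter.atTop
      (nhds (Real.log (eV A i))) := by
    refine Filter.Tendsto.log ?_ ha.ne'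
    simpa using (tendsto_inv_atTop_zero.const_mul (eV B j)).add_const (eV A i)
  refine h5.congr' ?_
  filter_upwards [Filter.eventually_gt_atTop 0] with T hT
  rw [← Real.log_div (by positivity) hT.ne']
  congr 1
  field_simp

lemma relEnt_le_of_Qs {ι : Type*} (t : Finset ι) (w : ι → ℝ) {A₀ B₀ : Matrix n n ℂ}
    (A B : ι → Matrix n n ℂ) (hA : ∀ l, (A l).PosDef) (hB : ∀ l, (B l).PosDef)
    (hA' : A₀.PosDef) (hB' : B₀.PosDef) (hrt : rt A₀ = ∑ l ∈ t, w l * rt (A l))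
    (hQ : ∀ s, 0 ≤ s → Qs s A₀ B₀ ≤ ∑ l ∈ t, w l * Qs s (A l) (B l)) :
    relEnt A₀ B₀ ≤ ∑ l ∈ t, w l * relEnt (A l) (B l) := by
  have hd : ∀ T, 0 ≤ T → HasDerivAt (fun T => ∑ l ∈ t, w l * IT T (A l) (B l) - IT T A₀ B₀)
      (∑ l ∈ t, w l * Qs T (A l) (B l) - Qs T A₀ B₀) T := fun T hT =>
    (HasDerivAt.fun_sum fun l _ => (IT_deriv (hA l) (hB l) hT).const_mul (w l)).sub
      (IT_deriv hA' hB' hT)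
  have hmono : MonotoneOn (fun T => ∑ l ∈ t, w l * IT T (A l) (B l) - IT T A₀ B₀)
      (Set.Ici 0) := by
    refine monotoneOn_of_deriv_nonneg (convex_Ici 0)
      (fun T hT => (hd T hT).continuousAt.continuousWithinAt) ?_ ?_
    · intro T hT
      rw [interior_Ici] at hT
      exact (hd T (le_of_lt hT)).differentiableAt.differentiableWithinAt
    · intro T hT
      rw [interior_Ici] at hT
      rw [(hd T (le_of_lt hT)).deriv]
      linarith [hQ T (le_of_lt hT)]
  have hI : ∀ T, 0 ≤ T → IT T A₀ B₀ ≤ ∑ l ∈ t, w l * IT T (A l) (B l) := by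
    intro T hT
    have := hmono (Set.mem_Ici.2 le_rfl) (Set.mem_Ici.2 hT) hT
    simp only [IT_zero, mul_zero, Finset.sum_const_zero, sub_zero] at this
    linarith
  have hlim : Filter.Tendsto (fun T => ∑ l ∈ t, w l * (IT T (A l) (B l) - rt (A l) * Real.log T))
      Filter.atTop (nhds (∑ l ∈ t, w l * relEnt (A l) (B l))) :=
    tendsto_finsetSum _ fun l _ => (IT_tendsto (hA l) (hB l)).const_mul _
  refine le_of_tendsto_of_tendsto (IT_tendsto hA' hB') hlim ?_
  filter_upwards [Filter.eventually_ge_atTop 0] with T hT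
  have : ∑ l ∈ t, w l * (IT T (A l) (B l) - rt (A l) * Real.log T) =
      ∑ l ∈ t, w l * IT T (A l) (B l) - rt A₀ * Real.log T := by
    rw [hrt, Finset.sum_mul, ← Finset.sum_sub_distrib]
    exact Finset.sum_congr rfl fun l _ => by ring
  rw [this]
  linarith [hI T hT]

/-- joint convexity of the relative entropy -/
lemma relEnt_convex {ι : Type*} (t : Finset ι) (w : ι → ℝ) (hw : ∀ l, 0 ≤ w l)
    (A B : ι → Matrix n n ℂ) (hA : ∀ l, (A l).PosDef) (hB : ∀ l, (B l).PosDef)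
    (hA' : (∑ l ∈ t, w l • A l).PosDef) (hB' : (∑ l ∈ t, w l • B l).PosDef) :
    relEnt (∑ l ∈ t, w l • A l) (∑ l ∈ t, w l • B l) ≤ ∑ l ∈ t, w l * relEnt (A l) (B l) :=
  relEnt_le_of_Qs t w A B hA hB hA' hB' (by simp only [rt_sum, rt_smul])
    fun _ hs => Qs_convex t w hw hs A B hA hB hA' hB'

/-- the relative entropy is antitone in the second argument -/
lemma relEnt_nonpos {A B : Matrix n n ℂ} (hA : A.PosDef) (hB : B.PosDef)
    (h : (B - A).PosSemidef) : relEnt A B ≤ 0 := by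
  have := relEnt_le_of_Qs (ι := Unit) Finset.univ (fun _ => 1) (A₀ := A) (B₀ := B)
    (fun _ => A) (fun _ => A) (fun _ => hA) (fun _ => hA) hA hB (by simp)
    (fun s hs => by simpa using Qs_anti hs hA hA hB h)
  simpa [relEnt_self] using this

end JointConvexity

/-! ### Superadditivity of the entropy gap over product distributions -/

section Superadd

set_option linter.unusedSectionVars false
set_option linter.unusedVariables false

variable {n : Type} [Fintype n] [DecidableEq n]

/-- negative entropy -/
def Sent (A : Matrix n n ℂ) : ℝ := rt (A * mlog A)

lemma avg_posDef {Z : Type*} [Fintype Z] {w : Z → ℝ} (hw : ∀ z, 0 ≤ w z) (hw1 : ∑ z, w z = 1)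
    {A : Z → Matrix n n ℂ} (hA : ∀ z, (A z).PosDef) : (∑ z, w z • A z).PosDef := by
  classical
  obtain ⟨z, hz⟩ : ∃ z, 0 < w z := by
    by_contra h
    push Not at h
    have : ∑ z, w z ≤ 0 := Finset.sum_nonpos fun z _ => h z
    linarith
  rw [← Finset.add_sum_erase _ _ (Finset.mem_univ z)]
  refine Matrix.PosDef.add_posSemidef ((hA z).smul hz) ?_
  exact posSemidef_sum _ fun i _ => (hA i).posSemidef.smul (hw i)

lemma gap_eq {X : Type*} [Fintype X] (μ : X → ℝ) (ρ : X → Matrix n n ℂ) :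
    ∑ x, μ x * Sent (ρ x) - Sent (∑ x, μ x • ρ x) =
      ∑ x, μ x * relEnt (ρ x) (∑ x, μ x • ρ x) := by
  have : Sent (∑ x, μ x • ρ x) = ∑ x, μ x * rt (ρ x * mlog (∑ x, μ x • ρ x)) := by
    unfold Sent
    rw [Finset.sum_mul, rt_sum]
    simp only [smul_mul_assoc, rt_smul]
  rw [this, ← Finset.sum_sub_distrib]
  exact Finset.sum_congr rfl fun x _ => by rw [relEnt, Sent]; ring

lemma gap_convex {Z X : Type*} [Fintype Z] [Fintype X] {ν : Z → ℝ} {μ : X → ℝ}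
    (hν : ∀ z, 0 ≤ ν z) (hν1 : ∑ z, ν z = 1) (hμ : ∀ x, 0 ≤ μ x) (hμ1 : ∑ x, μ x = 1)
    (ρ : Z → X → Matrix n n ℂ) (hρ : ∀ z x, (ρ z x).PosDef) :
    ∑ x, μ x * Sent (∑ z, ν z • ρ z x) - Sent (∑ z, ν z • ∑ x, μ x • ρ z x) ≤
      ∑ z, ν z * (∑ x, μ x * Sent (ρ z x) - Sent (∑ x, μ x • ρ z x)) := by
  have h1 : ∑ z, ν z • ∑ x, μ x • ρ z x = ∑ x, μ x • ∑ z, ν z • ρ z x := by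
    simp only [Finset.smul_sum]
    rw [Finset.sum_comm]
    exact Finset.sum_congr rfl fun x _ => Finset.sum_congr rfl fun z _ => smul_comm _ _ _
  simp only [gap_eq]
  rw [h1, gap_eq, ← h1]
  have h2 : ∑ z, ν z * ∑ x, μ x * relEnt (ρ z x) (∑ x, μ x • ρ z x) =
      ∑ x, μ x * ∑ z, ν z * relEnt (ρ z x) (∑ x, μ x • ρ z x) := by
    simp only [Finset.mul_sum]
    rw [Finset.sum_comm]
    exact Finset.sum_congr rfl fun x _ => Finset.sum_congr rfl fun z _ => by ring
  rw [h2]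
  refine Finset.sum_le_sum fun x _ => mul_le_mul_of_nonneg_left ?_ (hμ x)
  exact relEnt_convex Finset.univ ν hν (fun z => ρ z x) (fun z => ∑ x, μ x • ρ z x)
    (fun z => hρ z x) (fun z => avg_posDef hμ hμ1 (hρ z)) (avg_posDef hν hν1 fun z => hρ z x)
    (avg_posDef hν hν1 fun z => avg_posDef hμ hμ1 (hρ z))

variable {ι X : Type} [Fintype ι] [DecidableEq ι] [Fintype X]

/-- product weight -/
def wt (μ : X → ℝ) (z : ι → X) : ℝ := ∏ i, μ (z i)

lemma wt_nonneg {μ : X → ℝ} (hμ : ∀ x, 0 ≤ μ x) (z : ι → X) : 0 ≤ wt μ z :=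
  Finset.prod_nonneg fun i _ => hμ _

lemma wt_sum {μ : X → ℝ} (hμ1 : ∑ x, μ x = 1) : ∑ z : ι → X, wt μ z = 1 := by
  classical
  have := Finset.prod_univ_sum (fun _ : ι => (Finset.univ : Finset X)) (fun _ x => μ x)
  rw [Fintype.piFinset_univ] at this
  unfold wt
  rw [← this]
  simp [hμ1]

lemma wt_update (μ : X → ℝ) (z : ι → X) (j : ι) (x : X) :
    wt μ (Function.update z j x) * μ (z j) = wt μ z * μ x := by
  unfold wt
  rw [← Finset.mul_prod_erase _ _ (Finset.mem_univ j),
    ← Finset.mul_prod_erase _ (fun i => μ (z i)) (Finset.mem_univ j)]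
  have : ∏ i ∈ Finset.univ.erase j, μ (Function.update z j x i) =
      ∏ i ∈ Finset.univ.erase j, μ (z i) :=
    Finset.prod_congr rfl fun i hi => by
      rw [Function.update_of_ne (Finset.ne_of_mem_erase hi)]
  rw [this]
  simp
  ring

lemma resample {V : Type*} [AddCommGroup V] [Module ℝ V] {μ : X → ℝ} (hμ1 : ∑ x, μ x = 1)
    (j : ι) (f : (ι → X) → V) :
    ∑ z : ι → X, wt μ z • ∑ x, μ x • f (Function.update z j x) = ∑ z : ι → X, wt μ z • f z := by
  have hinv : Function.Involutive (fun p : (ι → X) × X => (Function.update p.1 j p.2, p.1 j)) := by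
    rintro ⟨z, x⟩
    simp
  have h1 := Equiv.sum_comp hinv.toPerm (fun p : (ι → X) × X => (wt μ p.1 * μ p.2) • f p.1)
  simp only [Function.Involutive.coe_toPerm, wt_update] at h1
  rw [Fintype.sum_prod_type, Fintype.sum_prod_type] at h1
  simp only [Finset.smul_sum, smul_smul]
  rw [h1]
  refine Finset.sum_congr rfl fun z _ => ?_
  dsimp only
  rw [← Finset.sum_smul, ← Finset.mul_sum, hμ1, mul_one]

lemma wt_piecewise (μ : X → ℝ) (s : Finset ι) (z w : ι → X) :
    wt μ (s.piecewise z w) * wt μ (s.piecewise w z) = wt μ z * wt μ w := by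
  unfold wt
  rw [← Finset.prod_mul_distrib, ← Finset.prod_mul_distrib]
  refine Finset.prod_congr rfl fun i _ => ?_
  by_cases h : i ∈ s
  · simp [h]
  · simp [h, mul_comm]

lemma resample_piecewise {V : Type*} [AddCommGroup V] [Module ℝ V] {μ : X → ℝ}
    (hμ1 : ∑ x, μ x = 1) (s : Finset ι) (f : (ι → X) → V) :
    ∑ z : ι → X, wt μ z • ∑ w : ι → X, wt μ w • f (s.piecewise z w) =
      ∑ z : ι → X, wt μ z • f z := by
  have hinv : Function.Involutive (fun p : (ι → X) × (ι → X) =>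
      (s.piecewise p.1 p.2, s.piecewise p.2 p.1)) := by
    rintro ⟨z, w⟩
    ext i <;> by_cases h : i ∈ s <;> simp [h]
  have h1 := Equiv.sum_comp hinv.toPerm
    (fun p : (ι → X) × (ι → X) => (wt μ p.1 * wt μ p.2) • f p.1)
  simp only [Function.Involutive.coe_toPerm, wt_piecewise] at h1
  rw [Fintype.sum_prod_type, Fintype.sum_prod_type] at h1
  simp only [Finset.smul_sum, smul_smul]
  rw [h1]
  refine Finset.sum_congr rfl fun z _ => ?_
  dsimp only
  rw [← Finset.sum_smul, ← Finset.mul_sum, wt_sum hμ1, mul_one]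

/-- average conditioned on coordinate `j` being `x` -/
def condAvg (μ : X → ℝ) (ρ : (ι → X) → Matrix n n ℂ) (j : ι) (x : X) : Matrix n n ℂ :=
  ∑ z : ι → X, wt μ z • ρ (Function.update z j x)

lemma condAvg_avg {μ : X → ℝ} (hμ1 : ∑ x, μ x = 1) (ρ : (ι → X) → Matrix n n ℂ) (j : ι) :
    ∑ x, μ x • condAvg μ ρ j x = ∑ z : ι → X, wt μ z • ρ z := by
  rw [← resample hμ1 j]
  simp only [condAvg, Finset.smul_sum]
  rw [Finset.sum_comm]
  exact Finset.sum_congr rfl fun x _ => Finset.sum_congr rfl fun z _ => smul_comm _ _ _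

/-- average over the coordinates outside `s` -/
def subAvg (μ : X → ℝ) (ρ : (ι → X) → Matrix n n ℂ) (s : Finset ι) (z : ι → X) : Matrix n n ℂ :=
  ∑ w : ι → X, wt μ w • ρ (s.piecewise z w)

lemma superadd_aux {μ : X → ℝ} (hμ : ∀ x, 0 ≤ μ x) (hμ1 : ∑ x, μ x = 1)
    (ρ : (ι → X) → Matrix n n ℂ) (hρ : ∀ z, (ρ z).PosDef) (s : Finset ι) :
    ∑ j ∈ s, (∑ x, μ x * Sent (condAvg μ ρ j x) - Sent (∑ z : ι → X, wt μ z • ρ z)) ≤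
      ∑ z : ι → X, wt μ z * Sent (subAvg μ ρ s z) - Sent (∑ z : ι → X, wt μ z • ρ z) := by
  induction s using Finset.induction_on with
  | empty =>
    have : ∀ z : ι → X, subAvg μ ρ ∅ z = ∑ z : ι → X, wt μ z • ρ z := by
      intro z; simp [subAvg]
    simp only [this, ← Finset.sum_mul, wt_sum hμ1]
    simp
  | insert j s hj ih =>
    rw [Finset.sum_insert hj]
    have hpw : ∀ (z w : ι → X) (x : X), (insert j s).piecewise (Function.update z j x) w =
        Function.update (s.piecewise z w) j x := by
      intro z w x
      ext i
      by_cases hi : i = j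
      · subst hi; simp
      · by_cases h : i ∈ s <;> simp [hi, h]
    have hpw2 : ∀ (z w : ι → X) (x : X), Function.update (s.piecewise z w) j x =
        s.piecewise z (Function.update w j x) := by
      intro z w x
      ext i
      by_cases hi : i = j
      · subst hi; simp [hj]
      · by_cases h : i ∈ s <;> simp [hi, h]
    have e1 : ∀ z, subAvg μ ρ s z =
        ∑ x, μ x • subAvg μ ρ (insert j s) (Function.update z j x) := by
      intro z
      unfold subAvg
      rw [← resample hμ1 j (fun w => ρ (s.piecewise z w))]
      simp only [Finset.smul_sum, hpw, hpw2]
      rw [Finset.sum_comm]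
      exact Finset.sum_congr rfl fun x _ => Finset.sum_congr rfl fun z _ => smul_comm _ _ _
    have e2 : ∀ x, ∑ z : ι → X, wt μ z • subAvg μ ρ (insert j s) (Function.update z j x) =
        condAvg μ ρ j x := by
      intro x
      unfold subAvg condAvg
      simp only [hpw]
      exact resample_piecewise hμ1 s (fun z => ρ (Function.update z j x))
    have e3 : ∑ z : ι → X, wt μ z * Sent (subAvg μ ρ (insert j s) z) =
        ∑ z : ι → X, wt μ z * ∑ x, μ x *
          Sent (subAvg μ ρ (insert j s) (Function.update z j x)) := by
      have := resample (V := ℝ) hμ1 j (fun z => Sent (subAvg μ ρ (insert j s) z))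
      simp only [smul_eq_mul] at this
      exact this.symm
    have g := gap_convex (ν := fun z : ι → X => wt μ z) (wt_nonneg hμ) (wt_sum hμ1) hμ hμ1
      (fun z x => subAvg μ ρ (insert j s) (Function.update z j x))
      (fun z x => avg_posDef (wt_nonneg hμ) (wt_sum hμ1) fun w => hρ _)
    simp only [e2, ← e1] at g
    have e4 : ∑ z : ι → X, wt μ z • subAvg μ ρ s z = ∑ z : ι → X, wt μ z • ρ z :=
      resample_piecewise hμ1 s ρ
    rw [e4] at g
    simp only [mul_sub, Finset.sum_sub_distrib] at g
    rw [← e3] at g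
    linarith

/-- main information-theoretic estimate -/
lemma superadd {μ : X → ℝ} (hμ : ∀ x, 0 ≤ μ x) (hμ1 : ∑ x, μ x = 1)
    (ρ : (ι → X) → Matrix n n ℂ) (hρ : ∀ z, (ρ z).PosDef) (τ : Matrix n n ℂ) (hτ : τ.PosDef)
    (hle : ∀ z, (τ - ρ z).PosSemidef) (hn : 0 < rt (∑ z : ι → X, wt μ z • ρ z)) (hm : 0 < rt τ) :
    ∑ j, ∑ x, μ x * rt ((msqrt (condAvg μ ρ j x) - msqrt (∑ z : ι → X, wt μ z • ρ z))ᴴ *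
        (msqrt (condAvg μ ρ j x) - msqrt (∑ z : ι → X, wt μ z • ρ z))) ≤
      rt (∑ z : ι → X, wt μ z • ρ z) *
        Real.log (rt τ / rt (∑ z : ι → X, wt μ z • ρ z)) := by
  set ρb := ∑ z : ι → X, wt μ z • ρ z with hρb
  have hb : ρb.PosDef := avg_posDef (wt_nonneg hμ) (wt_sum hμ1) hρ
  have hc : ∀ j x, (condAvg μ ρ j x).PosDef := fun j x =>
    avg_posDef (wt_nonneg hμ) (wt_sum hμ1) fun z => hρ _
  have h1 : ∀ j, ∑ x, μ x * rt ((msqrt (condAvg μ ρ j x) - msqrt ρb)ᴴ *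
        (msqrt (condAvg μ ρ j x) - msqrt ρb)) ≤
        ∑ x, μ x * Sent (condAvg μ ρ j x) - Sent ρb := by
    intro j
    have hg := gap_eq μ (fun x => condAvg μ ρ j x)
    rw [condAvg_avg hμ1, ← hρb] at hg
    rw [hg]
    have ht : ∑ x, μ x * rt (condAvg μ ρ j x) = rt ρb := by
      rw [hρb, ← condAvg_avg hμ1 ρ j, rt_sum]
      simp only [rt_smul]
    calc _ ≤ ∑ x, μ x * (relEnt (condAvg μ ρ j x) ρb + rt ρb - rt (condAvg μ ρ j x)) :=
          Finset.sum_le_sum fun x _ => mul_le_mul_of_nonneg_left (hellinger_le (hc j x) hb) (hμ x)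
      _ = ∑ x, μ x * relEnt (condAvg μ ρ j x) ρb := by
          simp only [mul_sub, mul_add, Finset.sum_sub_distrib, Finset.sum_add_distrib]
          rw [ht, ← Finset.sum_mul, hμ1]
          ring
  have h2 := superadd_aux hμ hμ1 ρ hρ Finset.univ
  have h3 : ∀ z, subAvg μ ρ Finset.univ z = ρ z := by
    intro z
    unfold subAvg
    simp [← Finset.sum_smul, wt_sum hμ1]
  simp only [h3] at h2
  refine (Finset.sum_le_sum fun j _ => h1 j).trans (h2.trans ?_)
  have h4 : ∑ z : ι → X, wt μ z * Sent (ρ z) - Sent ρb ≤ - relEnt ρb τ := by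
    have : ∑ z : ι → X, wt μ z * Sent (ρ z) ≤ ∑ z : ι → X, wt μ z * rt (ρ z * mlog τ) := by
      refine Finset.sum_le_sum fun z _ => mul_le_mul_of_nonneg_left ?_ (wt_nonneg hμ z)
      have := relEnt_nonpos (hρ z) hτ (hle z)
      unfold relEnt at this
      unfold Sent
      linarith
    have h5 : rt (ρb * mlog τ) = ∑ z : ι → X, wt μ z * rt (ρ z * mlog τ) := by
      rw [hρb, Finset.sum_mul, rt_sum]
      simp only [smul_mul_assoc, rt_smul]
    unfold relEnt
    unfold Sent at this ⊢
    linarith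
  exact h4.trans (klein hb hτ hn hm)

end Superadd

/-! ### The single-coordinate estimate -/

section Single

set_option linter.unusedSectionVars false
set_option linter.unusedVariables false

variable {n : Type} [Fintype n] [DecidableEq n]

/-- squared Frobenius norm -/
def fn (A : Matrix n n ℂ) : ℝ := rt (Aᴴ * A)

lemma fn_nonneg (A : Matrix n n ℂ) : 0 ≤ fn A :=
  rt_nonneg (posSemidef_conjTranspose_mul_self A)

lemma fn_conj (A : Matrix n n ℂ) : fn Aᴴ = fn A := by
  unfold fn; rw [conjTranspose_conjTranspose, rt_mul_comm]

lemma fn_left {U : Matrix n n ℂ} (hU : Uᴴ * U = 1) (A : Matrix n n ℂ) : fn (U * A) = fn A := by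
  unfold fn
  rw [conjTranspose_mul, mul_assoc, ← mul_assoc Uᴴ, hU, one_mul]

lemma fn_right {U : Matrix n n ℂ} (hU : Uᴴ * U = 1) (A : Matrix n n ℂ) : fn (A * U) = fn A := by
  rw [← fn_conj, conjTranspose_mul, fn_left, fn_conj]
  rw [conjTranspose_conjTranspose]
  exact mul_eq_one_comm.1 hU

/-- sesquilinear term -/
def tq (A B φ : Matrix n n ℂ) : ℝ := rt (φᴴ * A * φ * B)

lemma tq_nonneg {A B : Matrix n n ℂ} (hA : A.PosSemidef) (hB : B.PosSemidef)
    (φ : Matrix n n ℂ) : 0 ≤ tq A B φ :=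
  rt_mul_nonneg (hA.conjTranspose_mul_mul_same φ) hB

lemma tq_add_le {A B : Matrix n n ℂ} (hA : A.PosSemidef) (hB : B.PosSemidef)
    (φ δ : Matrix n n ℂ) {l : ℝ} (hl : 0 < l) :
    tq A B (φ + δ) ≤ (1 + l) * tq A B φ + (1 + 1 / l) * tq A B δ := by
  have h := tq_nonneg hA hB (l • φ - δ)
  have e1 : tq A B (l • φ - δ) = l ^ 2 * tq A B φ - l * (rt (φᴴ * A * δ * B) +
      rt (δᴴ * A * φ * B)) + tq A B δ := by
    unfold tq
    rw [conjTranspose_sub, conjTranspose_smul, star_trivial]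
    simp only [sub_mul, mul_sub, smul_mul_assoc, mul_smul_comm, rt_sub, rt_smul]
    ring
  have e2 : tq A B (φ + δ) = tq A B φ + (rt (φᴴ * A * δ * B) +
      rt (δᴴ * A * φ * B)) + tq A B δ := by
    unfold tq
    rw [conjTranspose_add]
    simp only [add_mul, mul_add, rt_add]
    ring
  rw [e1] at h
  rw [e2]
  have h2 : rt (φᴴ * A * δ * B) + rt (δᴴ * A * φ * B) ≤ l * tq A B φ + 1 / l * tq A B δ := by
    have h3 : 0 ≤ (l ^ 2 * tq A B φ - l * (rt (φᴴ * A * δ * B) +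
      rt (δᴴ * A * φ * B)) + tq A B δ) / l := div_nonneg h hl.le
    have h4 : (l ^ 2 * tq A B φ - l * (rt (φᴴ * A * δ * B) +
      rt (δᴴ * A * φ * B)) + tq A B δ) / l = l * tq A B φ - (rt (φᴴ * A * δ * B) +
      rt (δᴴ * A * φ * B)) + 1 / l * tq A B δ := by
      field_simp
    linarith
  linarith

lemma fn_add_le (φ δ : Matrix n n ℂ) : fn (φ + δ) ≤ 2 * fn φ + 2 * fn δ := by
  have := tq_add_le (A := (1 : Matrix n n ℂ)) (B := 1) PosSemidef.one PosSemidef.one φ δ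
    (l := 1) one_pos
  simp only [tq, mul_one] at this
  unfold fn
  linarith

lemma polar {G : Matrix n n ℂ} (hG : IsUnit G) :
    ∃ W : Matrix n n ℂ, Wᴴ * W = 1 ∧ G = W * msqrt (Gᴴ * G) := by
  have hp : (Gᴴ * G).PosDef := by
    have := (PosDef.one (n := n) (R := ℂ)).conjTranspose_mul_mul_same
      (B := G) (Matrix.mulVec_injective_iff_isUnit.2 hG)
    simpa using this
  have hu := msqrt_isUnit hp
  have hd := (Matrix.isUnit_iff_isUnit_det _).1 hu
  set R := msqrt (Gᴴ * G) with hR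
  have hRR : R * R = Gᴴ * G := msqrt_mul hp
  have hRh : Rᴴ = R := msqrt_herm _
  refine ⟨G * R⁻¹, ?_, ?_⟩
  · rw [conjTranspose_mul, conjTranspose_nonsing_inv, hRh]
    have : R⁻¹ * Gᴴ * (G * R⁻¹) = R⁻¹ * (Gᴴ * G) * R⁻¹ := by simp only [mul_assoc]
    rw [this, ← hRR, ← mul_assoc, Matrix.nonsing_inv_mul _ hd, one_mul,
      Matrix.mul_nonsing_inv _ hd]
  · rw [mul_assoc, Matrix.nonsing_inv_mul _ hd, mul_one]

lemma dist_unitary {G1 G0 : Matrix n n ℂ} (h1 : IsUnit G1) (h0 : IsUnit G0) :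
    ∃ U : Matrix n n ℂ, Uᴴ * U = 1 ∧
      fn (G1 - U * G0) = fn (msqrt (G1ᴴ * G1) - msqrt (G0ᴴ * G0)) := by
  obtain ⟨W1, hW1, e1⟩ := polar h1
  obtain ⟨W0, hW0, e0⟩ := polar h0
  have hW0' := mul_eq_one_comm.1 hW0
  refine ⟨W1 * W0ᴴ, ?_, ?_⟩
  · rw [conjTranspose_mul, conjTranspose_conjTranspose, mul_assoc, ← mul_assoc W1ᴴ, hW1, one_mul,
      hW0']
  · have : G1 - W1 * W0ᴴ * G0 = W1 * (msqrt (G1ᴴ * G1) - msqrt (G0ᴴ * G0)) := by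
      have e2 : W0ᴴ * G0 = msqrt (G0ᴴ * G0) := by
        conv_lhs => rw [e0]
        rw [← mul_assoc, hW0, one_mul]
      rw [mul_sub, mul_assoc, e2, ← e1]
    rw [this, fn_left hW1]

variable {X Y A B : Type} [Fintype X] [Fintype Y] [Fintype A] [Fintype B]

/-- winning weight of a strategy in trace form -/
def win (μX : X → ℝ) (μY : Y → ℝ) (V : X → Y → A → B → Bool) (K : Matrix n n ℂ)
    (P : X → A → Matrix n n ℂ) (R : Y → B → Matrix n n ℂ) : ℝ :=
  ∑ x, ∑ y, μX x * μY y * ∑ a, ∑ b, (if V x y a b then 1 else 0) * tq (P x a) (R y b) K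

lemma win_quad {P : A → Matrix n n ℂ} {R : B → Matrix n n ℂ}
    (hP : ∀ a, (P a).PosSemidef) (hP1 : ∑ a, P a = 1)
    (hR : ∀ b, (R b).PosSemidef) (hR1 : ∑ b, R b = 1) (v : A → B → Bool)
    (φ : Matrix n n ℂ) :
    ∑ a, ∑ b, (if v a b then 1 else 0) * tq (P a) (R b) φ ≤ fn φ := by
  have h1 : ∑ a, ∑ b, tq (P a) (R b) φ = fn φ := by
    unfold tq fn
    simp only [← rt_sum, ← Matrix.mul_sum, hR1, ← Matrix.sum_mul, hP1, mul_one]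
  rw [← h1]
  refine Finset.sum_le_sum fun a _ => Finset.sum_le_sum fun b _ => ?_
  have := tq_nonneg (hP a) (hR b) φ
  split_ifs <;> linarith

lemma win_perturb {P : A → Matrix n n ℂ} {R : B → Matrix n n ℂ}
    (hP : ∀ a, (P a).PosSemidef) (hP1 : ∑ a, P a = 1)
    (hR : ∀ b, (R b).PosSemidef) (hR1 : ∑ b, R b = 1) (v : A → B → Bool)
    (φ δ : Matrix n n ℂ) {l : ℝ} (hl : 0 < l) :
    ∑ a, ∑ b, (if v a b then 1 else 0) * tq (P a) (R b) (φ + δ) ≤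
      ∑ a, ∑ b, (if v a b then 1 else 0) * tq (P a) (R b) φ + l * fn φ + (1 + 1 / l) * fn δ := by
  have h1 : ∑ a, ∑ b, (if v a b then 1 else 0) * tq (P a) (R b) (φ + δ) ≤
      (1 + l) * ∑ a, ∑ b, (if v a b then 1 else 0) * tq (P a) (R b) φ +
      (1 + 1 / l) * ∑ a, ∑ b, (if v a b then 1 else 0) * tq (P a) (R b) δ := by
    rw [Finset.mul_sum, Finset.mul_sum, ← Finset.sum_add_distrib]
    refine Finset.sum_le_sum fun a _ => ?_
    rw [Finset.mul_sum, Finset.mul_sum, ← Finset.sum_add_distrib]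
    refine Finset.sum_le_sum fun b _ => ?_
    have := tq_add_le (hP a) (hR b) φ δ hl
    split_ifs
    · linarith
    · simp
  have h2 := win_quad hP hP1 hR hR1 v φ
  have h3 := win_quad hP hP1 hR hR1 v δ
  have h4 : 0 < 1 + 1 / l := by positivity
  nlinarith

lemma normalize_povm {M : A → Matrix n n ℂ} (hM : ∀ a, (M a).PosSemidef)
    (hS : (∑ a, M a).PosDef) :
    ∃ P : A → Matrix n n ℂ, (∀ a, (P a).PosSemidef) ∧ ∑ a, P a = 1 ∧
      ∀ a, M a = msqrt (∑ a, M a) * P a * msqrt (∑ a, M a) := by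
  have hu := msqrt_isUnit hS
  have hd := (Matrix.isUnit_iff_isUnit_det _).1 hu
  have hRR := msqrt_mul hS
  have hRh := msqrt_herm (∑ a, M a)
  set S := ∑ a, M a with hSd
  set R := msqrt S with hR
  have hih : (R⁻¹)ᴴ = R⁻¹ := by rw [conjTranspose_nonsing_inv, hRh]
  refine ⟨fun a => R⁻¹ * M a * R⁻¹, fun a => ?_, ?_, fun a => ?_⟩
  · have := (hM a).mul_mul_conjTranspose_same R⁻¹
    rwa [hih] at this
  · rw [← Finset.sum_mul, ← Finset.mul_sum, ← hSd, ← hRR, ← mul_assoc,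
      Matrix.nonsing_inv_mul _ hd, one_mul, Matrix.mul_nonsing_inv _ hd]
  · have : R * (R⁻¹ * M a * R⁻¹) * R = (R * R⁻¹) * M a * (R⁻¹ * R) := by simp only [mul_assoc]
    rw [this, Matrix.nonsing_inv_mul _ hd, Matrix.mul_nonsing_inv _ hd, one_mul, mul_one]

lemma povm_conj {P : A → Matrix n n ℂ} (hP1 : ∑ a, P a = 1) {U : Matrix n n ℂ}
    (hU : Uᴴ * U = 1) : ∑ a, Uᴴ * P a * U = 1 := by
  rw [← Finset.sum_mul, ← Finset.mul_sum, hP1, mul_one, hU]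

lemma single_coord {μX : X → ℝ} {μY : Y → ℝ}
    (hμX0 : ∀ x, 0 ≤ μX x) (hμX1 : ∑ x : X, μX x = 1)
    (hμY0 : ∀ y, 0 ≤ μY y) (hμY1 : ∑ y : Y, μY y = 1)
    (V : X → Y → A → B → Bool) (c : ℝ)
    (hG : ∀ (K : Matrix n n ℂ) (P : X → A → Matrix n n ℂ) (R : Y → B → Matrix n n ℂ),
      (∀ x a, (P x a).PosSemidef) → (∀ x, ∑ a, P x a = 1) →
      (∀ y b, (R y b).PosSemidef) → (∀ y, ∑ b, R y b = 1) → win μX μY V K P R ≤ c * fn K)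
    {K : Matrix n n ℂ} (hK : IsUnit K)
    (M : X → A → Matrix n n ℂ) (N : Y → B → Matrix n n ℂ)
    (hM : ∀ x a, (M x a).PosSemidef) (hM' : ∀ x, (∑ a, M x a).PosDef)
    (hN : ∀ y b, (N y b).PosSemidef) (hN' : ∀ y, (∑ b, N y b).PosDef)
    (Mb Nb : Matrix n n ℂ) (hMb : Mb = ∑ x, μX x • ∑ a, M x a)
    (hNb : Nb = ∑ y, μY y • ∑ b, N y b) {l : ℝ} (hl : 0 < l) :
    win μX μY V K M N ≤ (c + l) * rt (Kᴴ * Mb * K * Nb) + (1 + 1 / l) * (2 *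
      (∑ x, μX x * fn (msqrt (msqrt Nb * Kᴴ * (∑ a, M x a) * K * msqrt Nb) -
        msqrt (msqrt Nb * Kᴴ * Mb * K * msqrt Nb)) +
       ∑ y, μY y * fn (msqrt (msqrt Mb * K * (∑ b, N y b) * Kᴴ * msqrt Mb) -
        msqrt (msqrt Mb * K * Nb * Kᴴ * msqrt Mb)))) := by
  have pMb : Mb.PosDef := hMb ▸ avg_posDef hμX0 hμX1 hM'
  have pNb : Nb.PosDef := hNb ▸ avg_posDef hμY0 hμY1 hN'
  have uMb := msqrt_isUnit pMb
  have uNb := msqrt_isUnit pNb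
  have hKh : IsUnit Kᴴ := hK.star
  set φ0 := msqrt Mb * K * msqrt Nb with hφ0
  have uφ0 : IsUnit φ0 := (uMb.mul hK).mul uNb
  have fφ0 : fn φ0 = rt (Kᴴ * Mb * K * Nb) := by
    unfold fn
    rw [hφ0, conjTranspose_mul, conjTranspose_mul, msqrt_herm, msqrt_herm, mul_assoc, rt_mul_comm]
    have : Kᴴ * msqrt Mb * (msqrt Mb * K * msqrt Nb) * msqrt Nb =
      Kᴴ * (msqrt Mb * msqrt Mb) * K * (msqrt Nb * msqrt Nb) := by simp only [mul_assoc]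
    rw [this, msqrt_mul pMb, msqrt_mul pNb]
  -- unitaries
  have hA : ∀ x, ∃ U : Matrix n n ℂ, Uᴴ * U = 1 ∧
      fn (msqrt (∑ a, M x a) * K * msqrt Nb - U * φ0) =
        fn (msqrt (msqrt Nb * Kᴴ * (∑ a, M x a) * K * msqrt Nb) -
        msqrt (msqrt Nb * Kᴴ * Mb * K * msqrt Nb)) := by
    intro x
    obtain ⟨U, hU, e⟩ := dist_unitary (G1 := msqrt (∑ a, M x a) * K * msqrt Nb) (G0 := φ0)
      (((msqrt_isUnit (hM' x)).mul hK).mul uNb) uφ0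
    refine ⟨U, hU, ?_⟩
    rw [e]
    have key : ∀ Q : Matrix n n ℂ, Q.PosDef → (msqrt Q * K * msqrt Nb)ᴴ * (msqrt Q * K * msqrt Nb)
        = msqrt Nb * Kᴴ * Q * K * msqrt Nb := by
      intro Q hQ
      rw [conjTranspose_mul, conjTranspose_mul, msqrt_herm, msqrt_herm]
      conv_rhs => rw [← msqrt_mul hQ]
      simp only [mul_assoc]
    rw [key _ (hM' x), hφ0, key _ pMb]
  have hB : ∀ y, ∃ U : Matrix n n ℂ, Uᴴ * U = 1 ∧
      fn (msqrt Mb * K * msqrt (∑ b, N y b) - φ0 * U) =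
        fn (msqrt (msqrt Mb * K * (∑ b, N y b) * Kᴴ * msqrt Mb) -
        msqrt (msqrt Mb * K * Nb * Kᴴ * msqrt Mb)) := by
    intro y
    obtain ⟨U, hU, e⟩ := dist_unitary (G1 := (msqrt Mb * K * msqrt (∑ b, N y b))ᴴ) (G0 := φ0ᴴ)
      ((uMb.mul hK).mul (msqrt_isUnit (hN' y))).star uφ0.star
    refine ⟨Uᴴ, ?_, ?_⟩
    · rw [conjTranspose_conjTranspose]
      exact mul_eq_one_comm.1 hU
    have e2 : (msqrt Mb * K * msqrt (∑ b, N y b) - φ0 * Uᴴ)ᴴ =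
      (msqrt Mb * K * msqrt (∑ b, N y b))ᴴ - U * φ0ᴴ := by
      rw [conjTranspose_sub, conjTranspose_mul φ0, conjTranspose_conjTranspose]
    rw [← fn_conj, e2, e]
    have key : ∀ Q : Matrix n n ℂ, Q.PosDef →
        (msqrt Mb * K * msqrt Q)ᴴᴴ * (msqrt Mb * K * msqrt Q)ᴴ
        = msqrt Mb * K * Q * Kᴴ * msqrt Mb := by
      intro Q hQ
      rw [conjTranspose_conjTranspose, conjTranspose_mul, conjTranspose_mul, msqrt_herm, msqrt_herm]
      conv_rhs => rw [← msqrt_mul hQ]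
      simp only [mul_assoc]
    rw [key _ (hN' y), hφ0, key _ pNb]
  choose U hU eU using hA
  choose W hW eW using hB
  choose P hP hP1 hPM using fun x => normalize_povm (hM x) (hM' x)
  choose R hR hR1 hRN using fun y => normalize_povm (hN y) (hN' y)
  have hWW : ∀ y, W y * (W y)ᴴ = 1 := fun y => mul_eq_one_comm.1 (hW y)
  -- strategy for the base game
  have hstrat := hG φ0 (fun x a => (U x)ᴴ * P x a * U x) (fun y b => W y * R y b * (W y)ᴴ)
    (fun x a => (hP x a).conjTranspose_mul_mul_same _) (fun x => povm_conj (hP1 x) (hU x))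
    (fun y b => (hR y b).mul_mul_conjTranspose_same _) (fun y => by
      have := povm_conj (hR1 y) (U := (W y)ᴴ) (by rw [conjTranspose_conjTranspose]; exact hWW y)
      simpa using this)
  have e1 : ∀ x y a b, tq ((U x)ᴴ * P x a * U x) (W y * R y b * (W y)ᴴ) φ0 =
      tq (P x a) (R y b) (U x * φ0 * W y) := by
    intro x y a b
    unfold tq
    rw [conjTranspose_mul (U x * φ0), conjTranspose_mul (U x)]
    have : φ0ᴴ * ((U x)ᴴ * P x a * U x) * φ0 * (W y * R y b * (W y)ᴴ) =
      (φ0ᴴ * (U x)ᴴ * P x a * U x * φ0 * W y * R y b) * (W y)ᴴ := by simp only [mul_assoc]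
    rw [this, rt_mul_comm]
    simp only [mul_assoc]
  have e2 : ∀ x y a b, tq (M x a) (N y b) K =
      tq (P x a) (R y b) (msqrt (∑ a, M x a) * K * msqrt (∑ b, N y b)) := by
    intro x y a b
    unfold tq
    conv_lhs => rw [hPM x a, hRN y b]
    rw [conjTranspose_mul, conjTranspose_mul, msqrt_herm, msqrt_herm]
    generalize msqrt (∑ a, M x a) = S
    generalize msqrt (∑ b, N y b) = T
    have : Kᴴ * (S * P x a * S) * K * (T * R y b * T) =
      (Kᴴ * S * P x a * S * K * T * R y b) * T := by simp only [mul_assoc]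
    rw [this, rt_mul_comm]
    simp only [mul_assoc]
  -- distances
  set gA := fun x => fn (msqrt (msqrt Nb * Kᴴ * (∑ a, M x a) * K * msqrt Nb) -
        msqrt (msqrt Nb * Kᴴ * Mb * K * msqrt Nb)) with hgA
  set gB := fun y => fn (msqrt (msqrt Mb * K * (∑ b, N y b) * Kᴴ * msqrt Mb) -
        msqrt (msqrt Mb * K * Nb * Kᴴ * msqrt Mb)) with hgB
  set Z := fun x => (msqrt (∑ a, M x a) - U x * msqrt Mb) * K with hZ
  set δ := fun x y => msqrt (∑ a, M x a) * K * msqrt (∑ b, N y b) - U x * φ0 * W y with hδ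
  have hd : ∀ x y, fn (δ x y) ≤ 2 * fn (Z x * msqrt (∑ b, N y b)) + 2 * gB y := by
    intro x y
    have : δ x y = Z x * msqrt (∑ b, N y b) +
        U x * (msqrt Mb * K * msqrt (∑ b, N y b) - φ0 * W y) := by
      simp only [hδ, hZ, sub_mul, mul_sub, mul_assoc]
      abel
    rw [this]
    refine (fn_add_le _ _).trans ?_
    rw [fn_left (hU x), eW y]
  have hZsum : ∀ x, ∑ y, μY y * fn (Z x * msqrt (∑ b, N y b)) = gA x := by
    intro x
    have key : ∀ Q : Matrix n n ℂ, Q.PosDef → fn (Z x * msqrt Q) = rt ((Z x)ᴴ * Z x * Q) := by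
      intro Q hQ
      unfold fn
      rw [conjTranspose_mul, msqrt_herm, mul_assoc, rt_mul_comm]
      conv_rhs => rw [← msqrt_mul hQ]
      simp only [mul_assoc]
    have h1 : ∑ y, μY y * fn (Z x * msqrt (∑ b, N y b)) = fn (Z x * msqrt Nb) := by
      rw [key _ pNb, hNb, Matrix.mul_sum, rt_sum]
      refine Finset.sum_congr rfl fun y _ => ?_
      rw [key _ (hN' y), mul_smul_comm, rt_smul]
    rw [h1]
    simp only [hgA]
    rw [← eU x]
    congr 1
    simp only [hZ, hφ0, sub_mul, mul_assoc]
  have hsum : ∑ x, ∑ y, μX x * μY y * fn (δ x y) ≤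
      2 * (∑ x, μX x * gA x + ∑ y, μY y * gB y) := by
    calc _ ≤ ∑ x, ∑ y, μX x * μY y * (2 * fn (Z x * msqrt (∑ b, N y b)) + 2 * gB y) :=
          Finset.sum_le_sum fun x _ => Finset.sum_le_sum fun y _ =>
            mul_le_mul_of_nonneg_left (hd x y) (mul_nonneg (hμX0 x) (hμY0 y))
      _ = ∑ x, μX x * (2 * ∑ y, μY y * fn (Z x * msqrt (∑ b, N y b)) +
            2 * ∑ y, μY y * gB y) := by
          refine Finset.sum_congr rfl fun x _ => ?_
          rw [Finset.mul_sum, Finset.mul_sum, ← Finset.sum_add_distrib, Finset.mul_sum]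
          exact Finset.sum_congr rfl fun y _ => by ring
      _ = _ := by
          simp only [hZsum, mul_add, Finset.sum_add_distrib]
          rw [← Finset.sum_mul, hμX1]
          congr 1
          · rw [Finset.mul_sum]
            exact Finset.sum_congr rfl fun y _ => by ring
          · ring
  have hpt : ∀ x y, ∑ a, ∑ b, (if V x y a b then 1 else 0) * tq (M x a) (N y b) K ≤
      ∑ a, ∑ b, (if V x y a b then 1 else 0) * tq (P x a) (R y b) (U x * φ0 * W y) +
        l * fn φ0 + (1 + 1 / l) * fn (δ x y) := by
    intro x y
    have := win_perturb (hP x) (hP1 x) (hR y) (hR1 y) (V x y) (U x * φ0 * W y) (δ x y) hl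
    have e3 : U x * φ0 * W y + δ x y = msqrt (∑ a, M x a) * K * msqrt (∑ b, N y b) := by
      simp [hδ]
    rw [e3, fn_right (hW y), fn_left (hU x)] at this
    simpa only [e2] using this
  unfold win at hstrat ⊢
  simp only [e1] at hstrat
  have hone : ∑ x, ∑ y, μX x * μY y * (l * fn φ0) = l * fn φ0 := by
    simp only [← Finset.sum_mul, ← Finset.mul_sum, hμY1, mul_one, hμX1, one_mul]
  have hfin : ∑ x, ∑ y, μX x * μY y *
      ∑ a, ∑ b, (if V x y a b then 1 else 0) * tq (M x a) (N y b) K ≤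
      ∑ x, ∑ y, μX x * μY y *
        ∑ a, ∑ b, (if V x y a b then 1 else 0) * tq (P x a) (R y b) (U x * φ0 * W y) +
      l * fn φ0 + (1 + 1 / l) * ∑ x, ∑ y, μX x * μY y * fn (δ x y) := by
    rw [← hone]
    simp only [Finset.mul_sum (a := 1 + 1 / l)]
    simp only [← Finset.sum_add_distrib]
    refine Finset.sum_le_sum fun x _ => Finset.sum_le_sum fun y _ => ?_
    have := mul_le_mul_of_nonneg_left (hpt x y) (mul_nonneg (hμX0 x) (hμY0 y))
    linarith
  have hl4 : 0 < 1 + 1 / l := by positivity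
  have := mul_le_mul_of_nonneg_left hsum hl4.le
  rw [← fφ0]
  linarith

end Single

/-! ### Bound for a fixed conditioning -/

section PerR

set_option linter.unusedSectionVars false
set_option linter.unusedVariables false

variable {n : Type} [Fintype n] [DecidableEq n]
variable {X Y A B : Type} [Fintype X] [Fintype Y] [Fintype A] [Fintype B]
variable {ι : Type} [Fintype ι] [DecidableEq ι]

lemma tq_sum_left {Z : Type*} (s : Finset Z) (F : Z → Matrix n n ℂ) (R K : Matrix n n ℂ) :
    tq (∑ z ∈ s, F z) R K = ∑ z ∈ s, tq (F z) R K := by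
  unfold tq
  rw [Matrix.mul_sum, Matrix.sum_mul, Matrix.sum_mul, rt_sum]

lemma tq_sum_right {Z : Type*} (s : Finset Z) (F : Z → Matrix n n ℂ) (R K : Matrix n n ℂ) :
    tq R (∑ z ∈ s, F z) K = ∑ z ∈ s, tq R (F z) K := by
  unfold tq
  rw [Matrix.mul_sum, rt_sum]

lemma tq_smul_left (r : ℝ) (F R K : Matrix n n ℂ) : tq (r • F) R K = r * tq F R K := by
  unfold tq
  rw [mul_smul_comm, smul_mul_assoc, smul_mul_assoc, rt_smul]

lemma tq_smul_right (r : ℝ) (F R K : Matrix n n ℂ) : tq R (r • F) K = r * tq R F K := by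
  unfold tq
  rw [mul_smul_comm, rt_smul]

lemma tq_zero_left (R K : Matrix n n ℂ) : tq 0 R K = 0 := by simp [tq, rt]
lemma tq_zero_right (R K : Matrix n n ℂ) : tq R 0 K = 0 := by simp [tq, rt]

lemma marg_left [DecidableEq A] {Z A' : Type*} [Fintype Z] [Fintype A'] (w : Z → ℝ) (g : A' → A)
    (F : Z → A' → Matrix n n ℂ) (R K : Matrix n n ℂ) (v : A → ℝ) :
    ∑ a, v a * tq (∑ z, w z • ∑ a', if g a' = a then F z a' else 0) R K =
      ∑ z, w z * ∑ a', v (g a') * tq (F z a') R K := by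
  simp only [tq_sum_left, tq_smul_left, Finset.mul_sum]
  rw [Finset.sum_comm]
  refine Finset.sum_congr rfl fun z _ => ?_
  rw [Finset.sum_comm]
  refine Finset.sum_congr rfl fun a' _ => ?_
  rw [Finset.sum_eq_single (g a')]
  · simp only [if_true]; ring
  · intro b _ hb
    rw [if_neg (Ne.symm hb), tq_zero_left]; ring
  · simp

lemma marg_right [DecidableEq A] {Z A' : Type*} [Fintype Z] [Fintype A'] (w : Z → ℝ) (g : A' → A)
    (F : Z → A' → Matrix n n ℂ) (R K : Matrix n n ℂ) (v : A → ℝ) :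
    ∑ a, v a * tq R (∑ z, w z • ∑ a', if g a' = a then F z a' else 0) K =
      ∑ z, w z * ∑ a', v (g a') * tq R (F z a') K := by
  simp only [tq_sum_right, tq_smul_right, Finset.mul_sum]
  rw [Finset.sum_comm]
  refine Finset.sum_congr rfl fun z _ => ?_
  rw [Finset.sum_comm]
  refine Finset.sum_congr rfl fun a' _ => ?_
  rw [Finset.sum_eq_single (g a')]
  · simp only [if_true]; ring
  · intro b _ hb
    rw [if_neg (Ne.symm hb), tq_zero_right]; ring
  · simp

lemma marg_sum [DecidableEq A] {Z A' : Type*} [Fintype Z] [Fintype A'] (w : Z → ℝ) (g : A' → A)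
    (F : Z → A' → Matrix n n ℂ) :
    ∑ a, (∑ z, w z • ∑ a', if g a' = a then F z a' else 0) = ∑ z, w z • ∑ a', F z a' := by
  rw [Finset.sum_comm]
  refine Finset.sum_congr rfl fun z _ => ?_
  rw [← Finset.smul_sum]
  congr 1
  rw [Finset.sum_comm]
  refine Finset.sum_congr rfl fun a' _ => ?_
  simp

/-- winning weight in coordinate `j` -/
def winC (μX : X → ℝ) (μY : Y → ℝ) (V : X → Y → A → B → Bool) (K : Matrix n n ℂ)
    (Mf : (ι → X) → (ι → A) → Matrix n n ℂ) (Nf : (ι → Y) → (ι → B) → Matrix n n ℂ) (j : ι) : ℝ :=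
  ∑ z, wt μX z * ∑ z', wt μY z' * ∑ a, ∑ b,
    (if V (z j) (z' j) (a j) (b j) then 1 else 0) * tq (Mf z a) (Nf z' b) K

lemma win_eq_winC [DecidableEq A] [DecidableEq B] {μX : X → ℝ} {μY : Y → ℝ}
    (hμX1 : ∑ x : X, μX x = 1) (hμY1 : ∑ y : Y, μY y = 1)
    (V : X → Y → A → B → Bool) (K : Matrix n n ℂ)
    (Mf : (ι → X) → (ι → A) → Matrix n n ℂ) (Nf : (ι → Y) → (ι → B) → Matrix n n ℂ) (j : ι) :
    win μX μY V K
      (fun x a => ∑ z, wt μX z • ∑ a', if a' j = a then Mf (Function.update z j x) a' else 0)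
      (fun y b => ∑ z, wt μY z • ∑ b', if b' j = b then Nf (Function.update z j y) b' else 0) =
    winC μX μY V K Mf Nf j := by
  have h1 : ∀ x y, ∑ a, ∑ b, (if V x y a b then (1:ℝ) else 0) *
      tq (∑ z, wt μX z • ∑ a', if a' j = a then Mf (Function.update z j x) a' else 0)
        (∑ z, wt μY z • ∑ b', if b' j = b then Nf (Function.update z j y) b' else 0) K =
      ∑ z, wt μX z * ∑ z', wt μY z' * ∑ a', ∑ b', (if V x y (a' j) (b' j) then 1 else 0) *
        tq (Mf (Function.update z j x) a') (Nf (Function.update z' j y) b') K := by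
    intro x y
    rw [Finset.sum_comm]
    simp only [marg_left (wt μX) (fun a' : ι → A => a' j)]
    rw [Finset.sum_comm]
    refine Finset.sum_congr rfl fun z _ => ?_
    rw [← Finset.mul_sum, Finset.sum_comm]
    congr 1
    simp only [marg_right (wt μY) (fun a' : ι → B => a' j)]
    rw [Finset.sum_comm]
    refine Finset.sum_congr rfl fun z' _ => ?_
    rw [Finset.mul_sum]
  unfold win winC
  simp only [h1]
  have r1 := resample hμX1 j (fun z => ∑ z', wt μY z' * ∑ a, ∑ b,
    (if V (z j) (z' j) (a j) (b j) then 1 else 0) * tq (Mf z a) (Nf z' b) K)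
  simp only [smul_eq_mul] at r1
  rw [← r1]
  have r2 : ∀ z x, ∑ z', wt μY z' * ∑ a, ∑ b,
    (if V (Function.update z j x j) (z' j) (a j) (b j) then 1 else 0) *
      tq (Mf (Function.update z j x) a) (Nf z' b) K = ∑ z', wt μY z' * ∑ y, μY y * ∑ a, ∑ b,
    (if V x y (a j) (b j) then 1 else 0) *
      tq (Mf (Function.update z j x) a) (Nf (Function.update z' j y) b) K := by
    intro z x
    have := resample hμY1 j (fun z' => ∑ a, ∑ b,
    (if V (Function.update z j x j) (z' j) (a j) (b j) then 1 else 0) *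
      tq (Mf (Function.update z j x) a) (Nf z' b) K)
    simp only [smul_eq_mul, Function.update_self] at this ⊢
    rw [this]
  simp only [r2]
  generalize hH : (fun x y z z' => ∑ a', ∑ b', (if V x y (a' j) (b' j) then (1:ℝ) else 0) *
        tq (Mf (Function.update z j x) a') (Nf (Function.update z' j y) b') K) = H
  have hH' : ∀ x y z z', ∑ a', ∑ b', (if V x y (a' j) (b' j) then (1:ℝ) else 0) *
        tq (Mf (Function.update z j x) a') (Nf (Function.update z' j y) b') K = H x y z z' := by
    intro x y z z'; rw [← hH]
  simp only [hH', Finset.mul_sum]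
  calc _ = ∑ x, ∑ z, ∑ y, ∑ z', μX x * μY y * (wt μX z * (wt μY z' * H x y z z')) :=
        Finset.sum_congr rfl fun x _ => Finset.sum_comm
    _ = ∑ z, ∑ x, ∑ y, ∑ z', μX x * μY y * (wt μX z * (wt μY z' * H x y z z')) := Finset.sum_comm
    _ = _ := by
      refine Finset.sum_congr rfl fun z _ => Finset.sum_congr rfl fun x _ => ?_
      rw [Finset.sum_comm]
      exact Finset.sum_congr rfl fun z' _ => Finset.sum_congr rfl fun y _ => by ring

lemma conj_posDef {R M : Matrix n n ℂ} (hM : M.PosDef) (hR : IsUnit R) : (Rᴴ * M * R).PosDef :=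
  hM.conjTranspose_mul_mul_same (Matrix.mulVec_injective_iff_isUnit.2 hR)

lemma rt_pos [Nonempty n] {M : Matrix n n ℂ} (hM : M.PosDef) : 0 < rt M :=
  (Complex.lt_def.1 hM.trace_pos).1

/-- one-sided use of superadditivity -/
lemma side {μ : X → ℝ} (hμ : ∀ x, 0 ≤ μ x) (hμ1 : ∑ x, μ x = 1) [Nonempty n]
    {R : Matrix n n ℂ} (hR : IsUnit R)
    (Mz : (ι → X) → Matrix n n ℂ) (hMd : ∀ z, (Mz z).PosDef) (hM1 : ∀ z, (1 - Mz z).PosSemidef)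
    (S : Finset ι) :
    ∑ j ∈ S, ∑ x, μ x * fn (msqrt (Rᴴ * condAvg μ Mz j x * R) -
        msqrt (Rᴴ * (∑ z : ι → X, wt μ z • Mz z) * R)) ≤
      rt (Rᴴ * (∑ z : ι → X, wt μ z • Mz z) * R) *
        Real.log (rt (Rᴴ * R) / rt (Rᴴ * (∑ z : ι → X, wt μ z • Mz z) * R)) := by
  have e1 : ∑ z : ι → X, wt μ z • (Rᴴ * Mz z * R) =
      Rᴴ * (∑ z : ι → X, wt μ z • Mz z) * R := by
    simp only [Matrix.mul_sum, Matrix.sum_mul, mul_smul_comm, smul_mul_assoc]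
  have e2 : ∀ j x, condAvg μ (fun z => Rᴴ * Mz z * R) j x = Rᴴ * condAvg μ Mz j x * R := by
    intro j x
    unfold condAvg
    simp only [Matrix.mul_sum, Matrix.sum_mul, mul_smul_comm, smul_mul_assoc]
  have hτ : (Rᴴ * R).PosDef := by
    have := conj_posDef (PosDef.one (n := n) (R := ℂ)) hR
    simpa using this
  have := superadd hμ hμ1 (fun z => Rᴴ * Mz z * R) (fun z => conj_posDef (hMd z) hR) (Rᴴ * R) hτ
    (fun z => by
      have := (hM1 z).conjTranspose_mul_mul_same R
      rwa [mul_sub, sub_mul, mul_one] at this)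
    (by rw [e1]; exact rt_pos (conj_posDef (avg_posDef (wt_nonneg hμ) (wt_sum hμ1) hMd) hR))
    (rt_pos hτ)
  simp only [e1, e2] at this
  refine le_trans ?_ this
  refine Finset.sum_le_univ_sum_of_nonneg fun j => Finset.sum_nonneg fun x _ => ?_
  exact mul_nonneg (hμ x) (fn_nonneg _)

lemma per_r [DecidableEq A] [DecidableEq B] [Nonempty n] {μX : X → ℝ} {μY : Y → ℝ}
    (hμX0 : ∀ x, 0 ≤ μX x) (hμX1 : ∑ x : X, μX x = 1)
    (hμY0 : ∀ y, 0 ≤ μY y) (hμY1 : ∑ y : Y, μY y = 1)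
    (V : X → Y → A → B → Bool) (c : ℝ)
    (hG : ∀ (K : Matrix n n ℂ) (P : X → A → Matrix n n ℂ) (R : Y → B → Matrix n n ℂ),
      (∀ x a, (P x a).PosSemidef) → (∀ x, ∑ a, P x a = 1) →
      (∀ y b, (R y b).PosSemidef) → (∀ y, ∑ b, R y b = 1) → win μX μY V K P R ≤ c * fn K)
    {K : Matrix n n ℂ} (hK : IsUnit K)
    (Mf : (ι → X) → (ι → A) → Matrix n n ℂ) (Nf : (ι → Y) → (ι → B) → Matrix n n ℂ)
    (hM : ∀ z a, (Mf z a).PosSemidef) (hMd : ∀ z, (∑ a, Mf z a).PosDef)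
    (hM1 : ∀ z, (1 - ∑ a, Mf z a).PosSemidef)
    (hN : ∀ z a, (Nf z a).PosSemidef) (hNd : ∀ z, (∑ a, Nf z a).PosDef)
    (hN1 : ∀ z, (1 - ∑ a, Nf z a).PosSemidef)
    (Mb Nb : Matrix n n ℂ) (hMb : Mb = ∑ z, wt μX z • ∑ a, Mf z a)
    (hNb : Nb = ∑ z, wt μY z • ∑ a, Nf z a) (S : Finset ι) {l : ℝ} (hl : 0 < l) :
    0 < tq Mb Nb K ∧ 0 < tq 1 Nb K ∧ 0 < tq Mb 1 K ∧
    ∑ j ∈ S, winC μX μY V K Mf Nf j ≤ S.card * ((c + l) * tq Mb Nb K) +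
      (1 + 1 / l) * (2 * (tq Mb Nb K * Real.log (tq 1 Nb K / tq Mb Nb K) +
        tq Mb Nb K * Real.log (tq Mb 1 K / tq Mb Nb K))) := by
  have pMb : Mb.PosDef := hMb ▸ avg_posDef (wt_nonneg hμX0) (wt_sum hμX1) hMd
  have pNb : Nb.PosDef := hNb ▸ avg_posDef (wt_nonneg hμY0) (wt_sum hμY1) hNd
  have uMb := msqrt_isUnit pMb
  have uNb := msqrt_isUnit pNb
  have uR : IsUnit (K * msqrt Nb) := hK.mul uNb
  have uT : IsUnit (Kᴴ * msqrt Mb) := hK.star.mul uMb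
  have eR : (K * msqrt Nb)ᴴ = msqrt Nb * Kᴴ := by rw [conjTranspose_mul, msqrt_herm]
  have eT : (Kᴴ * msqrt Mb)ᴴ = msqrt Mb * K := by
    rw [conjTranspose_mul, msqrt_herm, conjTranspose_conjTranspose]
  have cR : ∀ Q, rt ((K * msqrt Nb)ᴴ * Q * (K * msqrt Nb)) = tq Q Nb K := by
    intro Q
    unfold tq
    rw [eR]
    have : msqrt Nb * Kᴴ * Q * (K * msqrt Nb) = msqrt Nb * (Kᴴ * Q * K * msqrt Nb) := by
      simp only [mul_assoc]
    rw [this, rt_mul_comm, mul_assoc _ (msqrt Nb), msqrt_mul pNb]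
  have cT : ∀ Q, rt ((Kᴴ * msqrt Mb)ᴴ * Q * (Kᴴ * msqrt Mb)) = tq Mb Q K := by
    intro Q
    unfold tq
    rw [eT]
    have : msqrt Mb * K * Q * (Kᴴ * msqrt Mb) = (msqrt Mb * K * Q) * (Kᴴ * msqrt Mb) := by
      simp only [mul_assoc]
    rw [this, rt_mul_comm]
    have : Kᴴ * msqrt Mb * (msqrt Mb * K * Q) = Kᴴ * (msqrt Mb * msqrt Mb) * K * Q := by
      simp only [mul_assoc]
    rw [this, msqrt_mul pMb]
  have sA := side hμX0 hμX1 uR (fun z => ∑ a, Mf z a) hMd hM1 S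
  have sB := side hμY0 hμY1 uT (fun z => ∑ a, Nf z a) hNd hN1 S
  rw [← hMb, cR] at sA
  rw [← hNb, cT] at sB
  have cR1 := cR 1
  have cT1 := cT 1
  rw [mul_one] at cR1 cT1
  rw [cR1] at sA
  rw [cT1] at sB
  refine ⟨?_, ?_, ?_, ?_⟩
  · rw [← cR]; exact rt_pos (conj_posDef pMb uR)
  · rw [← cR]; exact rt_pos (conj_posDef PosDef.one uR)
  · rw [← cT]; exact rt_pos (conj_posDef PosDef.one uT)
  have hsc : ∀ j, winC μX μY V K Mf Nf j ≤ (c + l) * tq Mb Nb K + (1 + 1 / l) * (2 *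
      (∑ x, μX x * fn (msqrt ((K * msqrt Nb)ᴴ * condAvg μX (fun z => ∑ a, Mf z a) j x *
          (K * msqrt Nb)) - msqrt ((K * msqrt Nb)ᴴ * Mb * (K * msqrt Nb))) +
       ∑ y, μY y * fn (msqrt ((Kᴴ * msqrt Mb)ᴴ * condAvg μY (fun z => ∑ a, Nf z a) j y *
          (Kᴴ * msqrt Mb)) - msqrt ((Kᴴ * msqrt Mb)ᴴ * Nb * (Kᴴ * msqrt Mb))))) := by
    intro j
    rw [← win_eq_winC hμX1 hμY1]
    have eM : ∀ x, ∑ a, (∑ z, wt μX z • ∑ a' : ι → A,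
        if a' j = a then Mf (Function.update z j x) a' else 0) =
        condAvg μX (fun z => ∑ a, Mf z a) j x := by
      intro x
      rw [marg_sum (wt μX) (fun a' : ι → A => a' j)]
      rfl
    have eN : ∀ x, ∑ a, (∑ z, wt μY z • ∑ a' : ι → B,
        if a' j = a then Nf (Function.update z j x) a' else 0) =
        condAvg μY (fun z => ∑ a, Nf z a) j x := by
      intro x
      rw [marg_sum (wt μY) (fun a' : ι → B => a' j)]
      rfl
    have := single_coord hμX0 hμX1 hμY0 hμY1 V c hG hK
      (fun x a => ∑ z, wt μX z • ∑ a', if a' j = a then Mf (Function.update z j x) a' else 0)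
      (fun y b => ∑ z, wt μY z • ∑ b', if b' j = b then Nf (Function.update z j y) b' else 0)
      (fun x a => posSemidef_sum _ fun z _ => PosSemidef.smul
        (posSemidef_sum _ fun a' _ => by
          split_ifs
          · exact hM _ _
          · exact PosSemidef.zero) (wt_nonneg hμX0 z))
      (fun x => by
        rw [eM]; exact avg_posDef (wt_nonneg hμX0) (wt_sum hμX1) fun z => hMd _)
      (fun x a => posSemidef_sum _ fun z _ => PosSemidef.smul
        (posSemidef_sum _ fun a' _ => by
          split_ifs
          · exact hN _ _
          · exact PosSemidef.zero) (wt_nonneg hμY0 z))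
      (fun x => by
        rw [eN]; exact avg_posDef (wt_nonneg hμY0) (wt_sum hμY1) fun z => hNd _)
      Mb Nb (by simp only [eM]; rw [condAvg_avg hμX1, hMb])
      (by simp only [eN]; rw [condAvg_avg hμY1, hNb]) hl
    simp only [eM, eN] at this
    rw [eR, eT]
    simpa only [mul_assoc, tq] using this
  have h2 := Finset.sum_le_sum fun j (_ : j ∈ S) => hsc j
  rw [Finset.sum_add_distrib, Finset.sum_const, nsmul_eq_mul, ← Finset.mul_sum, ← Finset.mul_sum,
    Finset.sum_add_distrib] at h2
  refine h2.trans ?_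
  have : 0 < 1 + 1 / l := by positivity
  gcongr

end PerR
/-! ### Combining over conditionings -/

section Combine

set_option linter.unusedSectionVars false
set_option linter.unusedVariables false

variable {n : Type} [Fintype n] [DecidableEq n]
variable {X Y A B : Type} [Fintype X] [Fintype Y] [Fintype A] [Fintype B]
variable {ι : Type} [Fintype ι] [DecidableEq ι]

lemma logsum {R : Type*} [Fintype R] {w p t : R → ℝ} (hw : ∀ r, 0 ≤ w r) (hp : ∀ r, 0 < p r)
    (ht : ∀ r, 0 < t r) {q T : ℝ} (hq : q = ∑ r, w r * p r) (hq0 : 0 < q)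
    (hT : ∑ r, w r * t r ≤ T) (hT0 : 0 < T) :
    ∑ r, w r * (p r * Real.log (t r / p r)) ≤ q * Real.log (T / q) := by
  have h1 : ∀ r, w r * (p r * Real.log (t r / p r)) ≤
      w r * p r * Real.log (T / q) + (q / T) * (w r * t r) - w r * p r := by
    intro r
    have hx : 0 < (t r / p r) / (T / q) := by have := hp r; have := ht r; positivity
    have h2 := Real.log_le_sub_one_of_pos hx
    rw [Real.log_div (by have := hp r; have := ht r; positivity) (by positivity)] at h2
    have h3 : p r * Real.log (t r / p r) ≤
        p r * Real.log (T / q) + (q / T) * t r - p r := by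
      have h4 := mul_le_mul_of_nonneg_left h2 (hp r).le
      have h5 : p r * (t r / p r / (T / q) - 1) = (q / T) * t r - p r := by
        have := hp r
        field_simp
      rw [h5] at h4
      linarith
    have := mul_le_mul_of_nonneg_left h3 (hw r)
    linarith
  refine (Finset.sum_le_sum fun r _ => h1 r).trans ?_
  rw [Finset.sum_sub_distrib, Finset.sum_add_distrib, ← Finset.sum_mul, ← Finset.mul_sum, ← hq]
  have : q / T * ∑ r, w r * t r ≤ q / T * T := mul_le_mul_of_nonneg_left hT (by positivity)
  have h6 : q / T * T = q := by field_simp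
  linarith

lemma collapse1 {β Z Z' A' B' : Type*} [Fintype β] [Fintype Z] [Fintype Z'] [Fintype A']
    [Fintype B'] [DecidableEq β] (v : β → ℝ) (w : Z → ℝ) (w' : Z' → ℝ)
    (g : A' → B' → β) (T : Z → Z' → A' → B' → ℝ) :
    ∑ b, v b * ∑ z, w z * ∑ z', w' z' * ∑ a', ∑ b', (if g a' b' = b then 1 else 0) * T z z' a' b' =
      ∑ z, w z * ∑ z', w' z' * ∑ a', ∑ b', v (g a' b') * T z z' a' b' := by
  simp only [Finset.mul_sum]
  rw [Finset.sum_comm]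
  refine Finset.sum_congr rfl fun z _ => ?_
  rw [Finset.sum_comm]
  refine Finset.sum_congr rfl fun z' _ => ?_
  rw [Finset.sum_comm]
  refine Finset.sum_congr rfl fun a' _ => ?_
  rw [Finset.sum_comm]
  refine Finset.sum_congr rfl fun b' _ => ?_
  rw [Finset.sum_eq_single (g a' b')]
  · simp only [if_true]; ring
  · intro b _ hb
    rw [if_neg (Ne.symm hb)]; ring
  · simp

/-- restriction of an assignment to `C` -/
def res (C : Finset ι) (a : ι → A) : C → A := fun i => a i

/-- winning indicator on `C` -/
def vC (V : X → Y → A → B → Bool) (C : Finset ι) (x : ι → X) (y : ι → Y) (α : C → A) (β : C → B) :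
    ℝ := if ∀ i : C, V (x i) (y i) (α i) (β i) = true then 1 else 0

/-- weight of winning on `C` -/
def qC (μX : X → ℝ) (μY : Y → ℝ) (V : X → Y → A → B → Bool) (K : Matrix n n ℂ)
    (Al : (ι → X) → (ι → A) → Matrix n n ℂ) (Bo : (ι → Y) → (ι → B) → Matrix n n ℂ)
    (C : Finset ι) : ℝ :=
  ∑ x, wt μX x * ∑ y, wt μY y * ∑ a, ∑ b, vC V C x y (res C a) (res C b) * tq (Al x a) (Bo y b) K

/-- the conditioned operators -/
def cM [DecidableEq A] (Al : (ι → X) → (ι → A) → Matrix n n ℂ) (C : Finset ι) (u : ι → X)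
    (α : C → A) (z : ι → X) (a : ι → A) : Matrix n n ℂ :=
  if res C a = α then Al (C.piecewise u z) a else 0

lemma vC_nonneg (V : X → Y → A → B → Bool) (C : Finset ι) (x : ι → X) (y : ι → Y) (α : C → A)
    (β : C → B) : 0 ≤ vC V C x y α β := by
  unfold vC; split_ifs <;> norm_num

lemma vC_le_one (V : X → Y → A → B → Bool) (C : Finset ι) (x : ι → X) (y : ι → Y) (α : C → A)
    (β : C → B) : vC V C x y α β ≤ 1 := by
  unfold vC; split_ifs <;> norm_num

lemma vC_piecewise (V : X → Y → A → B → Bool) (C : Finset ι) (u z : ι → X) (v z' : ι → Y)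
    (α : C → A) (β : C → B) :
    vC V C (C.piecewise u z) (C.piecewise v z') α β = vC V C u v α β := by
  unfold vC
  simp

lemma vC_insert (V : X → Y → A → B → Bool) (C : Finset ι) (j : ι) (x : ι → X) (y : ι → Y)
    (a : ι → A) (b : ι → B) :
    vC V (insert j C) x y (res _ a) (res _ b) =
      vC V C x y (res C a) (res C b) * (if V (x j) (y j) (a j) (b j) then 1 else 0) := by
  unfold vC res
  simp only [Subtype.forall, Finset.forall_mem_insert]
  by_cases h1 : V (x j) (y j) (a j) (b j) = true
  · simp [h1]
  · simp [h1]

lemma combine_eq [DecidableEq A] [DecidableEq B] {μX : X → ℝ} {μY : Y → ℝ}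
    (hμX1 : ∑ x : X, μX x = 1) (hμY1 : ∑ y : Y, μY y = 1)
    (V : X → Y → A → B → Bool) (K : Matrix n n ℂ)
    (Al : (ι → X) → (ι → A) → Matrix n n ℂ) (Bo : (ι → Y) → (ι → B) → Matrix n n ℂ)
    (C : Finset ι) (g : (ι → X) → (ι → Y) → (ι → A) → (ι → B) → ℝ) :
    ∑ u, wt μX u * ∑ v, wt μY v * ∑ r : (C → A) × (C → B), vC V C u v r.1 r.2 *
      ∑ z, wt μX z * ∑ z', wt μY z' * ∑ a, ∑ b, g (C.piecewise u z) (C.piecewise v z') a b *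
        tq (cM Al C u r.1 z a) (cM Bo C v r.2 z' b) K =
    ∑ x, wt μX x * ∑ y, wt μY y * ∑ a, ∑ b, vC V C x y (res C a) (res C b) *
      (g x y a b * tq (Al x a) (Bo y b) K) := by
  have h1 : ∀ u v (r : (C → A) × (C → B)) z z' a b, g (C.piecewise u z) (C.piecewise v z') a b *
        tq (cM Al C u r.1 z a) (cM Bo C v r.2 z' b) K =
      (if (res C a, res C b) = r then 1 else 0) * (g (C.piecewise u z) (C.piecewise v z') a b *
        tq (Al (C.piecewise u z) a) (Bo (C.piecewise v z') b) K) := by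
    intro u v r z z' a b
    obtain ⟨α, β⟩ := r
    simp only [cM, Prod.mk.injEq]
    by_cases e1 : res C a = α
    · by_cases e2 : res C b = β
      · simp [e1, e2]
      · simp [e1, e2, tq_zero_right]
    · simp [e1, tq_zero_left]
  simp only [h1]
  simp only [collapse1]
  generalize hF : (fun x y => ∑ a, ∑ b, vC V C x y (res C a) (res C b) *
      (g x y a b * tq (Al x a) (Bo y b) K)) = F
  have hF' : ∀ x y, ∑ a, ∑ b, vC V C x y (res C a) (res C b) *
      (g x y a b * tq (Al x a) (Bo y b) K) = F x y := by
    intro x y; rw [← hF]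
  have hF2 : ∀ (u z : ι → X) (v z' : ι → Y), ∑ a, ∑ b,
      vC V C u v (res C a) (res C b) *
      (g (C.piecewise u z) (C.piecewise v z') a b *
        tq (Al (C.piecewise u z) a) (Bo (C.piecewise v z') b) K) =
      F (C.piecewise u z) (C.piecewise v z') := by
    intro u z v z'
    rw [← hF']
    simp only [vC_piecewise]
  simp only [hF2, hF']
  have r1 := resample_piecewise hμX1 C (fun x => ∑ y, wt μY y * F x y)
  simp only [smul_eq_mul] at r1
  rw [← r1]
  have r2 : ∀ x, ∑ v, wt μY v * ∑ z', wt μY z' * F x (C.piecewise v z') =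
      ∑ y, wt μY y * F x y := by
    intro x
    have := resample_piecewise hμY1 C (fun y => F x y)
    simpa only [smul_eq_mul] using this
  refine Finset.sum_congr rfl fun u _ => ?_
  congr 1
  simp only [← r2]
  simp only [Finset.mul_sum]
  rw [Finset.sum_comm]
  refine Finset.sum_congr rfl fun z _ => Finset.sum_congr rfl fun v _ => 
    Finset.sum_congr rfl fun z' _ => ?_
  ring

lemma cM_psd [DecidableEq A] {Al : (ι → X) → (ι → A) → Matrix n n ℂ}
    (hA : ∀ x a, (Al x a).PosDef) (C : Finset ι) (u : ι → X) (α : C → A) (z : ι → X) (a : ι → A) :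
    (cM Al C u α z a).PosSemidef := by
  unfold cM
  split_ifs
  · exact (hA _ _).posSemidef
  · exact PosSemidef.zero

lemma cM_posDef [DecidableEq A] [Nonempty A] {Al : (ι → X) → (ι → A) → Matrix n n ℂ}
    (hA : ∀ x a, (Al x a).PosDef) (C : Finset ι) (u : ι → X) (α : C → A) (z : ι → X) :
    (∑ a, cM Al C u α z a).PosDef := by
  obtain ⟨a0⟩ := ‹Nonempty A›
  have he : res C (fun i => if h : i ∈ C then α ⟨i, h⟩ else a0) = α := by
    funext i
    simp [res]
  rw [← Finset.add_sum_erase _ _ (Finset.mem_univ (fun i => if h : i ∈ C then α ⟨i, h⟩ else a0))]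
  refine PosDef.add_posSemidef ?_ (posSemidef_sum _ fun a _ => cM_psd hA C u α z a)
  unfold cM
  rw [if_pos he]
  exact hA _ _

lemma cM_le_one [DecidableEq A] {Al : (ι → X) → (ι → A) → Matrix n n ℂ}
    (hA : ∀ x a, (Al x a).PosDef) (hA1 : ∀ x, ∑ a, Al x a = 1) (C : Finset ι) (u : ι → X)
    (α : C → A) (z : ι → X) :
    (1 - ∑ a, cM Al C u α z a).PosSemidef := by
  rw [← hA1 (C.piecewise u z), ← Finset.sum_sub_distrib]
  refine posSemidef_sum _ fun a _ => ?_
  unfold cM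
  split_ifs
  · rw [sub_self]; exact PosSemidef.zero
  · rw [sub_zero]; exact (hA _ _).posSemidef

/-- averaged conditioned operator -/
def bM [DecidableEq A] (μX : X → ℝ) (Al : (ι → X) → (ι → A) → Matrix n n ℂ) (C : Finset ι)
    (u : ι → X) (α : C → A) : Matrix n n ℂ := ∑ z, wt μX z • ∑ a, cM Al C u α z a

lemma bM_sum [DecidableEq A] {μX : X → ℝ} (hμX1 : ∑ x : X, μX x = 1)
    {Al : (ι → X) → (ι → A) → Matrix n n ℂ} (hA1 : ∀ x, ∑ a, Al x a = 1) (C : Finset ι)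
    (u : ι → X) : ∑ α, bM μX Al C u α = 1 := by
  unfold bM cM
  rw [marg_sum (wt μX) (res C) (fun z a => Al (C.piecewise u z) a)]
  simp only [hA1]
  rw [← Finset.sum_smul, wt_sum hμX1, one_smul]

lemma tq_one_one (K : Matrix n n ℂ) : tq 1 1 K = fn K := by simp [tq, fn]

lemma step_sum [DecidableEq A] [DecidableEq B] [Nonempty A] [Nonempty B] [Nonempty n]
    {μX : X → ℝ} {μY : Y → ℝ}
    (hμX0 : ∀ x, 0 ≤ μX x) (hμX1 : ∑ x : X, μX x = 1)
    (hμY0 : ∀ y, 0 ≤ μY y) (hμY1 : ∑ y : Y, μY y = 1)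
    (V : X → Y → A → B → Bool) (c : ℝ)
    (hG : ∀ (K : Matrix n n ℂ) (P : X → A → Matrix n n ℂ) (R : Y → B → Matrix n n ℂ),
      (∀ x a, (P x a).PosSemidef) → (∀ x, ∑ a, P x a = 1) →
      (∀ y b, (R y b).PosSemidef) → (∀ y, ∑ b, R y b = 1) → win μX μY V K P R ≤ c * fn K)
    {K : Matrix n n ℂ} (hK : IsUnit K) (hK1 : fn K = 1)
    {Al : (ι → X) → (ι → A) → Matrix n n ℂ} {Bo : (ι → Y) → (ι → B) → Matrix n n ℂ}
    (hA : ∀ x a, (Al x a).PosDef) (hA1 : ∀ x, ∑ a, Al x a = 1)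
    (hB : ∀ x a, (Bo x a).PosDef) (hB1 : ∀ x, ∑ a, Bo x a = 1)
    (C : Finset ι) (hq0 : 0 < qC μX μY V K Al Bo C) {l : ℝ} (hl : 0 < l) :
    ∑ j ∈ Cᶜ, qC μX μY V K Al Bo (insert j C) ≤
      (Cᶜ.card : ℝ) * ((c + l) * qC μX μY V K Al Bo C) + (1 + 1 / l) * (2 *
        (qC μX μY V K Al Bo C * Real.log ((Fintype.card A : ℝ) ^ C.card / qC μX μY V K Al Bo C) +
         qC μX μY V K Al Bo C *
          Real.log ((Fintype.card B : ℝ) ^ C.card / qC μX μY V K Al Bo C))) := by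
  set q := qC μX μY V K Al Bo C with hq
  -- index of conditionings
  let R := (ι → X) × (ι → Y) × (C → A) × (C → B)
  let w : R → ℝ := fun r => wt μX r.1 * (wt μY r.2.1 * vC V C r.1 r.2.1 r.2.2.1 r.2.2.2)
  let p : R → ℝ := fun r => tq (bM μX Al C r.1 r.2.2.1) (bM μY Bo C r.2.1 r.2.2.2) K
  let tA : R → ℝ := fun r => tq 1 (bM μY Bo C r.2.1 r.2.2.2) K
  let tB : R → ℝ := fun r => tq (bM μX Al C r.1 r.2.2.1) 1 K
  let W : R → ι → ℝ := fun r j => winC μX μY V K (cM Al C r.1 r.2.2.1) (cM Bo C r.2.1 r.2.2.2) j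
  have hper := fun r : R => per_r hμX0 hμX1 hμY0 hμY1 V c hG hK (cM Al C r.1 r.2.2.1)
    (cM Bo C r.2.1 r.2.2.2) (cM_psd hA C _ _) (cM_posDef hA C _ _) (cM_le_one hA hA1 C _ _)
    (cM_psd hB C _ _) (cM_posDef hB C _ _) (cM_le_one hB hB1 C _ _)
    (bM μX Al C r.1 r.2.2.1) (bM μY Bo C r.2.1 r.2.2.2) rfl rfl Cᶜ hl
  have hw : ∀ r, 0 ≤ w r := fun r => mul_nonneg (wt_nonneg hμX0 _)
    (mul_nonneg (wt_nonneg hμY0 _) (vC_nonneg _ _ _ _ _ _))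
  have hp : ∀ r, 0 < p r := fun r => (hper r).1
  have htA : ∀ r, 0 < tA r := fun r => (hper r).2.1
  have htB : ∀ r, 0 < tB r := fun r => (hper r).2.2.1
  have hsumR : ∀ f : R → ℝ, ∑ r, w r * f r = ∑ u, wt μX u * ∑ v, wt μY v *
      ∑ s : (C → A) × (C → B), vC V C u v s.1 s.2 * f (u, v, s) := by
    intro f
    rw [Fintype.sum_prod_type]
    refine Finset.sum_congr rfl fun u _ => ?_
    rw [Fintype.sum_prod_type, Finset.mul_sum]
    refine Finset.sum_congr rfl fun v _ => ?_
    rw [Finset.mul_sum, Finset.mul_sum]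
    refine Finset.sum_congr rfl fun s _ => ?_
    simp only [w]; ring
  have hqp : q = ∑ r, w r * p r := by
    rw [hsumR]
    have := combine_eq hμX1 hμY1 V K Al Bo C (fun _ _ _ _ => 1)
    simp only [one_mul] at this
    rw [hq, qC, ← this]
    refine Finset.sum_congr rfl fun u _ => ?_
    congr 1
    refine Finset.sum_congr rfl fun v _ => ?_
    congr 1
    refine Finset.sum_congr rfl fun s _ => ?_
    congr 1
    simp only [p, bM]
    rw [tq_sum_left]
    refine Finset.sum_congr rfl fun z _ => ?_
    rw [tq_smul_left, tq_sum_right]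
    congr 1
    refine Finset.sum_congr rfl fun z' _ => ?_
    rw [tq_smul_right, tq_sum_left]
    congr 1
    exact Finset.sum_congr rfl fun a _ => by rw [tq_sum_right]
  have hqW : ∀ j ∈ Cᶜ, qC μX μY V K Al Bo (insert j C) = ∑ r, w r * W r j := by
    intro j hj
    rw [Finset.mem_compl] at hj
    rw [hsumR]
    have := combine_eq hμX1 hμY1 V K Al Bo C
      (fun x y a b => if V (x j) (y j) (a j) (b j) then 1 else 0)
    simp only [Finset.piecewise_eq_of_notMem _ _ _ hj] at this
    rw [qC]
    simp only [W, winC]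
    rw [this]
    simp only [vC_insert, mul_assoc]
  have hu1 : ∑ u : ι → X, wt μX u = 1 := wt_sum hμX1
  have hv1 : ∑ v : ι → Y, wt μY v = 1 := wt_sum hμY1
  have hle : ∀ t : R → ℝ, (∀ r, 0 < t r) → ∑ r, w r * t r ≤ ∑ u, wt μX u * ∑ v, wt μY v *
      ∑ s : (C → A) × (C → B), t (u, v, s) := by
    intro t ht
    rw [hsumR]
    refine Finset.sum_le_sum fun u _ => mul_le_mul_of_nonneg_left ?_ (wt_nonneg hμX0 u)
    refine Finset.sum_le_sum fun v _ => mul_le_mul_of_nonneg_left ?_ (wt_nonneg hμY0 v)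
    refine Finset.sum_le_sum fun s _ => ?_
    exact mul_le_of_le_one_left (ht _).le (vC_le_one _ _ _ _ _ _)
  have hTA : ∑ r, w r * tA r ≤ (Fintype.card A : ℝ) ^ C.card := by
    refine (hle tA htA).trans (le_of_eq ?_)
    have : ∀ u v, ∑ s : (C → A) × (C → B), tA (u, v, s) = (Fintype.card A : ℝ) ^ C.card := by
      intro u v
      rw [Fintype.sum_prod_type]
      simp only [tA]
      simp only [← tq_sum_right, bM_sum hμY1 hB1, tq_one_one, hK1]
      simp
    simp only [this, ← Finset.sum_mul, hu1, hv1, one_mul]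
  have hTB : ∑ r, w r * tB r ≤ (Fintype.card B : ℝ) ^ C.card := by
    refine (hle tB htB).trans (le_of_eq ?_)
    have : ∀ u v, ∑ s : (C → A) × (C → B), tB (u, v, s) = (Fintype.card B : ℝ) ^ C.card := by
      intro u v
      rw [Fintype.sum_prod_type, Finset.sum_comm]
      simp only [tB]
      simp only [← tq_sum_left, bM_sum hμX1 hA1, tq_one_one, hK1]
      simp
    simp only [this, ← Finset.sum_mul, hu1, hv1, one_mul]
  have cA : (0:ℝ) < (Fintype.card A : ℝ) ^ C.card := by
    have : 0 < Fintype.card A := Fintype.card_pos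
    positivity
  have cB : (0:ℝ) < (Fintype.card B : ℝ) ^ C.card := by
    have : 0 < Fintype.card B := Fintype.card_pos
    positivity
  have LA := logsum hw hp htA hqp hq0 hTA cA
  have LB := logsum hw hp htB hqp hq0 hTB cB
  rw [Finset.sum_congr rfl hqW, Finset.sum_comm]
  have hmain : ∑ r, ∑ j ∈ Cᶜ, w r * W r j ≤ ∑ r, ((Cᶜ.card : ℝ) * (c + l) * (w r * p r) +
      (1 + 1 / l) * 2 * (w r * (p r * Real.log (tA r / p r)) +
        w r * (p r * Real.log (tB r / p r)))) := by
    refine Finset.sum_le_sum fun r _ => ?_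
    rw [← Finset.mul_sum]
    have := mul_le_mul_of_nonneg_left (hper r).2.2.2 (hw r)
    refine this.trans (le_of_eq ?_)
    simp only [p, tA, tB]
    ring
  refine hmain.trans ?_
  rw [Finset.sum_add_distrib, ← Finset.mul_sum, ← Finset.mul_sum, ← hqp, Finset.sum_add_distrib]
  have hl4 : 0 < (1 + 1 / l) * 2 := by positivity
  have := mul_le_mul_of_nonneg_left (add_le_add LA LB) hl4.le
  linarith

end Combine
/-! ### Iteration -/

section Iterate

set_option linter.unusedSectionVars false
set_option linter.unusedVariables false

variable {n : Type} [Fintype n] [DecidableEq n]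
variable {X Y A B : Type} [Fintype X] [Fintype Y] [Fintype A] [Fintype B]
variable {ι : Type} [Fintype ι] [DecidableEq ι]

lemma vC_anti (V : X → Y → A → B → Bool) {C D : Finset ι} (h : C ⊆ D) (x : ι → X) (y : ι → Y)
    (a : ι → A) (b : ι → B) :
    vC V D x y (res D a) (res D b) ≤ vC V C x y (res C a) (res C b) := by
  unfold vC res
  simp only [Subtype.forall]
  by_cases h1 : ∀ i ∈ D, V (x i) (y i) (a i) (b i) = true
  · rw [if_pos h1, if_pos fun i hi => h1 i (h hi)]
  · rw [if_neg h1]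
    split_ifs <;> norm_num

lemma qC_anti {μX : X → ℝ} {μY : Y → ℝ} (hμX0 : ∀ x, 0 ≤ μX x) (hμY0 : ∀ y, 0 ≤ μY y)
    (V : X → Y → A → B → Bool) {K : Matrix n n ℂ}
    {Al : (ι → X) → (ι → A) → Matrix n n ℂ} {Bo : (ι → Y) → (ι → B) → Matrix n n ℂ}
    (hA : ∀ x a, (Al x a).PosDef) (hB : ∀ x a, (Bo x a).PosDef) {C D : Finset ι} (h : C ⊆ D) :
    qC μX μY V K Al Bo D ≤ qC μX μY V K Al Bo C := by
  unfold qC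
  refine Finset.sum_le_sum fun u _ => mul_le_mul_of_nonneg_left ?_ (wt_nonneg hμX0 u)
  refine Finset.sum_le_sum fun v _ => mul_le_mul_of_nonneg_left ?_ (wt_nonneg hμY0 v)
  refine Finset.sum_le_sum fun a _ => Finset.sum_le_sum fun b _ => ?_
  exact mul_le_mul_of_nonneg_right (vC_anti V h _ _ _ _)
    (tq_nonneg (hA _ _).posSemidef (hB _ _).posSemidef _)

lemma qC_le_one {μX : X → ℝ} {μY : Y → ℝ} (hμX0 : ∀ x, 0 ≤ μX x) (hμX1 : ∑ x : X, μX x = 1)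
    (hμY0 : ∀ y, 0 ≤ μY y) (hμY1 : ∑ y : Y, μY y = 1)
    (V : X → Y → A → B → Bool) {K : Matrix n n ℂ} (hK1 : fn K = 1)
    {Al : (ι → X) → (ι → A) → Matrix n n ℂ} {Bo : (ι → Y) → (ι → B) → Matrix n n ℂ}
    (hA : ∀ x a, (Al x a).PosDef) (hA1 : ∀ x, ∑ a, Al x a = 1)
    (hB : ∀ x a, (Bo x a).PosDef) (hB1 : ∀ x, ∑ a, Bo x a = 1) (C : Finset ι) :
    qC μX μY V K Al Bo C ≤ 1 := by
  have hu1 : ∑ u : ι → X, wt μX u = 1 := wt_sum hμX1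
  have hv1 : ∑ v : ι → Y, wt μY v = 1 := wt_sum hμY1
  have h1 : ∀ x y, ∑ a, ∑ b, vC V C x y (res C a) (res C b) * tq (Al x a) (Bo y b) K ≤ 1 := by
    intro x y
    have h2 : ∑ a, ∑ b, tq (Al x a) (Bo y b) K = 1 := by
      simp only [← tq_sum_right, ← tq_sum_left, hA1, hB1, tq_one_one, hK1]
    rw [← h2]
    refine Finset.sum_le_sum fun a _ => Finset.sum_le_sum fun b _ => ?_
    exact mul_le_of_le_one_left (tq_nonneg (hA _ _).posSemidef (hB _ _).posSemidef _)
      (vC_le_one _ _ _ _ _ _)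
  calc qC μX μY V K Al Bo C ≤ ∑ x : ι → X, wt μX x * ∑ y : ι → Y, wt μY y * 1 := by
        unfold qC
        refine Finset.sum_le_sum fun u _ => mul_le_mul_of_nonneg_left ?_ (wt_nonneg hμX0 u)
        exact Finset.sum_le_sum fun v _ => mul_le_mul_of_nonneg_left (h1 u v) (wt_nonneg hμY0 v)
    _ = 1 := by simp only [mul_one, hu1, hv1]

/-- the numerical heart of the iteration step -/
lemma numeric {ε k m nn s T q LA : ℝ} (hε0 : 0 < ε) (hε1 : ε ≤ 1) (hk : 0 < k) (hs : 1 ≤ s)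
    (hT : T = ε ^ 2 * k / (12000 * s)) (hm0 : 0 ≤ m) (hm : m < T) (hnn : nn = k - m)
    (hq0 : 0 < q) (hLA : LA = m * (s * Real.log 2) + 2 * Real.log (1 / q))
    (hqT : Real.log (1 / q) ≤ T * Real.log 2) :
    nn * ((1 - ε + ε / 4) * q) + (1 + 1 / (ε / 4)) * (2 * (q * LA)) < nn * ((1 - ε / 2) * q) := by
  have hl2 := Real.log_two_lt_d9
  have hl2' := Real.log_two_gt_d9
  have hT0 : 0 < T := by rw [hT]; positivity
  have hTs : T * s = ε ^ 2 * k / 12000 := by rw [hT]; field_simp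
  have h1 : LA ≤ 2.1 * (T * s) := by
    have a1 : m * (s * Real.log 2) ≤ T * s * 0.7 := by
      have : m * (s * Real.log 2) ≤ T * (s * 0.7) := by
        gcongr; linarith
      linarith
    have a2 : T * Real.log 2 ≤ T * 0.7 := by gcongr; linarith
    have a3 : T ≤ T * s := le_mul_of_one_le_right hT0.le hs
    rw [hLA]; linarith
  have h2 : (1 + 1 / (ε / 4)) * LA ≤ 10.5 * (ε * k / 12000) := by
    have b1 : 1 + 1 / (ε / 4) ≤ 5 / ε := by
      rw [div_div_eq_mul_div, le_div_iff₀ hε0]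
      have : (1 + 1 * 4 / ε) * ε = ε + 4 := by field_simp
      linarith
    have b0 : 0 ≤ 1 + 1 / (ε / 4) := by positivity
    calc (1 + 1 / (ε / 4)) * LA ≤ (1 + 1 / (ε / 4)) * (2.1 * (T * s)) := by gcongr
      _ ≤ (5 / ε) * (2.1 * (T * s)) := by
          refine mul_le_mul_of_nonneg_right b1 (by positivity)
      _ = 10.5 * (ε * k / 12000) := by rw [hTs]; field_simp; norm_num
  have h3 : T ≤ k / 12000 := by
    have : T ≤ T * s := le_mul_of_one_le_right hT0.le hs
    have h4 : ε ^ 2 * k ≤ 1 * k := by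
      gcongr
      exact pow_le_one₀ hε0.le hε1
    linarith
  have h5 : nn * (ε / 4) > 2 * ((1 + 1 / (ε / 4)) * LA) := by
    have : nn ≥ k * 0.9 := by linarith
    have : nn * (ε / 4) ≥ k * 0.9 * (ε / 4) := by gcongr
    have : 0 < ε * k := by positivity
    linarith
  have := mul_lt_mul_of_pos_left h5 hq0
  linarith

lemma iterate_bound [DecidableEq A] [DecidableEq B] [Nonempty A] [Nonempty B] [Nonempty n]
    {μX : X → ℝ} {μY : Y → ℝ}
    (hμX0 : ∀ x, 0 ≤ μX x) (hμX1 : ∑ x : X, μX x = 1)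
    (hμY0 : ∀ y, 0 ≤ μY y) (hμY1 : ∑ y : Y, μY y = 1)
    (V : X → Y → A → B → Bool) {ε : ℝ} (hε0 : 0 < ε) (hε1 : ε ≤ 1)
    (hAB : 2 ≤ Fintype.card A * Fintype.card B)
    (hG : ∀ (K : Matrix n n ℂ) (P : X → A → Matrix n n ℂ) (R : Y → B → Matrix n n ℂ),
      (∀ x a, (P x a).PosSemidef) → (∀ x, ∑ a, P x a = 1) →
      (∀ y b, (R y b).PosSemidef) → (∀ y, ∑ b, R y b = 1) → win μX μY V K P R ≤ (1 - ε) * fn K)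
    {K : Matrix n n ℂ} (hK : IsUnit K) (hK1 : fn K = 1)
    {Al : (ι → X) → (ι → A) → Matrix n n ℂ} {Bo : (ι → Y) → (ι → B) → Matrix n n ℂ}
    (hA : ∀ x a, (Al x a).PosDef) (hA1 : ∀ x, ∑ a, Al x a = 1)
    (hB : ∀ x a, (Bo x a).PosDef) (hB1 : ∀ x, ∑ a, Bo x a = 1) [Nonempty ι] :
    qC μX μY V K Al Bo Finset.univ ≤ (1 - ε / 2) ^ (ε ^ 2 * (Fintype.card ι : ℝ) /
        (12000 * (Real.logb 2 (Fintype.card A) + Real.logb 2 (Fintype.card B)))) := by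
  have cA : 0 < Fintype.card A := Fintype.card_pos
  have cB : 0 < Fintype.card B := Fintype.card_pos
  have ck : 0 < Fintype.card ι := Fintype.card_pos
  have cA' : (0:ℝ) < Fintype.card A := by exact_mod_cast cA
  have cB' : (0:ℝ) < Fintype.card B := by exact_mod_cast cB
  have ck' : (0:ℝ) < Fintype.card ι := by exact_mod_cast ck
  set s := Real.logb 2 (Fintype.card A) + Real.logb 2 (Fintype.card B) with hs
  set T := ε ^ 2 * (Fintype.card ι : ℝ) / (12000 * s) with hT
  have l2 : 0 < Real.log 2 := Real.log_pos (by norm_num)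
  have hslog : s * Real.log 2 = Real.log (Fintype.card A) + Real.log (Fintype.card B) := by
    rw [hs, Real.logb, Real.logb]; field_simp
  have hs1 : 1 ≤ s := by
    have : Real.log 2 ≤ s * Real.log 2 := by
      rw [hslog, ← Real.log_mul cA'.ne' cB'.ne']
      exact Real.log_le_log (by norm_num) (by exact_mod_cast hAB)
    by_contra h
    push Not at h
    nlinarith
  have hT0 : 0 < T := by positivity
  have hb0 : 0 < 1 - ε / 2 := by linarith
  have hb1 : 1 - ε / 2 ≤ 1 := by linarith
  by_contra hcon
  push Not at hcon
  have hθ0 : 0 < (1 - ε / 2) ^ T := Real.rpow_pos_of_pos hb0 _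
  have hall : ∀ C : Finset ι, (1 - ε / 2) ^ T < qC μX μY V K Al Bo C := fun C =>
    hcon.trans_le (qC_anti hμX0 hμY0 V hA hB (Finset.subset_univ C))
  have hstep : ∀ C : Finset ι, (C.card : ℝ) < T → ∃ j, j ∉ C ∧
      qC μX μY V K Al Bo (insert j C) ≤ (1 - ε / 2) * qC μX μY V K Al Bo C := by
    intro C hC
    by_contra hno
    push Not at hno
    have hq0 : 0 < qC μX μY V K Al Bo C := hθ0.trans (hall C)
    have h1 := step_sum hμX0 hμX1 hμY0 hμY1 V (1 - ε) hG hK hK1 hA hA1 hB hB1 C hq0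
      (l := ε / 4) (by positivity)
    have h2 : (Cᶜ.card : ℝ) * ((1 - ε / 2) * qC μX μY V K Al Bo C) ≤
        ∑ j ∈ Cᶜ, qC μX μY V K Al Bo (insert j C) := by
      rw [← nsmul_eq_mul, ← Finset.sum_const]
      exact Finset.sum_le_sum fun j hj => (hno j (Finset.mem_compl.1 hj)).le
    have hqT : Real.log (1 / qC μX μY V K Al Bo C) ≤ T * Real.log 2 := by
      have e1 : Real.log ((1 - ε / 2) ^ T) ≤ Real.log (qC μX μY V K Al Bo C) :=
        Real.log_le_log hθ0 (hall C).le
      rw [Real.log_rpow hb0] at e1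
      have e2 : - Real.log 2 ≤ Real.log (1 - ε / 2) := by
        rw [← Real.log_inv]
        exact Real.log_le_log (by norm_num) (by linarith)
      have e3 := mul_le_mul_of_nonneg_left e2 hT0.le
      rw [one_div, Real.log_inv]
      linarith
    have hnn : (Cᶜ.card : ℝ) = (Fintype.card ι : ℝ) - (C.card : ℝ) := by
      rw [Finset.card_compl, Nat.cast_sub (Finset.card_le_univ C)]
    have h3 := numeric hε0 hε1 ck' hs1 hT (Nat.cast_nonneg C.card) hC hnn hq0 rfl hqT
    have h4 : Real.log ((Fintype.card A : ℝ) ^ C.card / qC μX μY V K Al Bo C) +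
        Real.log ((Fintype.card B : ℝ) ^ C.card / qC μX μY V K Al Bo C) =
        C.card * (s * Real.log 2) + 2 * Real.log (1 / qC μX μY V K Al Bo C) := by
      rw [hslog, Real.log_div (by positivity) hq0.ne', Real.log_div (by positivity) hq0.ne',
        Real.log_pow, Real.log_pow, one_div, Real.log_inv]
      ring
    rw [← mul_add, h4] at h1
    linarith
  have hind : ∀ m : ℕ, (m : ℝ) < T + 1 → ∃ C : Finset ι, C.card = m ∧
      qC μX μY V K Al Bo C ≤ (1 - ε / 2) ^ m := by
    intro m
    induction m with
    | zero =>
      intro _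
      refine ⟨∅, rfl, ?_⟩
      rw [pow_zero]
      exact qC_le_one hμX0 hμX1 hμY0 hμY1 V hK1 hA hA1 hB hB1 ∅
    | succ m ih =>
      intro hm
      push_cast at hm
      obtain ⟨C, hC, hCq⟩ := ih (by linarith)
      obtain ⟨j, hj, hjq⟩ := hstep C (by rw [hC]; linarith)
      refine ⟨insert j C, by rw [Finset.card_insert_of_notMem hj, hC], hjq.trans ?_⟩
      rw [pow_succ, mul_comm]
      gcongr
  obtain ⟨C, _, hC⟩ := hind ⌈T⌉₊ (Nat.ceil_lt_add_one hT0.le)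
  have h1 := hall C
  have h2 : (1 - ε / 2) ^ (⌈T⌉₊ : ℕ) ≤ (1 - ε / 2) ^ T := by
    rw [← Real.rpow_natCast]
    exact Real.rpow_le_rpow_of_exponent_ge hb0 hb1 (Nat.le_ceil T)
  linarith

end Iterate
/-! ### Reductions -/

section Reduce

set_option linter.unusedSectionVars false
set_option linter.unusedVariables false

variable {X Y A B : Type} [Fintype X] [Fintype Y] [Fintype A] [Fintype B]

section Sq
variable {n : Type} [Fintype n] [DecidableEq n]

lemma tq_smul_K (t : ℝ) (P R K : Matrix n n ℂ) : tq P R (t • K) = t ^ 2 * tq P R K := by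
  unfold tq
  rw [conjTranspose_smul, star_trivial]
  simp only [smul_mul_assoc, mul_smul_comm, rt_smul]
  ring

lemma fn_smul_K (t : ℝ) (K : Matrix n n ℂ) : fn (t • K) = t ^ 2 * fn K := by
  rw [← tq_one_one, tq_smul_K, tq_one_one]

lemma win_smul_K (μX : X → ℝ) (μY : Y → ℝ) (V : X → Y → A → B → Bool) (t : ℝ) (K : Matrix n n ℂ)
    (P : X → A → Matrix n n ℂ) (R : Y → B → Matrix n n ℂ) :
    win μX μY V (t • K) P R = t ^ 2 * win μX μY V K P R := by
  unfold win
  simp only [tq_smul_K, Finset.mul_sum]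
  refine Finset.sum_congr rfl fun x _ => Finset.sum_congr rfl fun y _ =>
    Finset.sum_congr rfl fun a _ => Finset.sum_congr rfl fun b _ => ?_
  ring

variable {ι : Type} [Fintype ι] [DecidableEq ι]

lemma qC_smul_K (μX : X → ℝ) (μY : Y → ℝ) (V : X → Y → A → B → Bool) (t : ℝ) (K : Matrix n n ℂ)
    (Al : (ι → X) → (ι → A) → Matrix n n ℂ) (Bo : (ι → Y) → (ι → B) → Matrix n n ℂ)
    (C : Finset ι) :
    qC μX μY V (t • K) Al Bo C = t ^ 2 * qC μX μY V K Al Bo C := by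
  unfold qC
  simp only [tq_smul_K, Finset.mul_sum]
  refine Finset.sum_congr rfl fun x _ => Finset.sum_congr rfl fun y _ =>
    Finset.sum_congr rfl fun a _ => Finset.sum_congr rfl fun b _ => ?_
  ring

lemma fn_eq_zero {K : Matrix n n ℂ} (h : fn K = 0) : K = 0 := by
  unfold fn at h
  rw [rt_conj_mul] at h
  ext i j
  have h1 := (Finset.sum_eq_zero_iff_of_nonneg (fun i _ => Finset.sum_nonneg fun j _ =>
    by positivity)).1 h j (Finset.mem_univ _)
  have h2 := (Finset.sum_eq_zero_iff_of_nonneg (fun i _ => by positivity)).1 h1 i (Finset.mem_univ _)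
  simpa using h2

lemma scale_one {K : Matrix n n ℂ} (h : 0 < fn K) : fn ((Real.sqrt (fn K))⁻¹ • K) = 1 := by
  rw [fn_smul_K, inv_pow, Real.sq_sqrt h.le, inv_mul_cancel₀ h.ne']

lemma unit_eventually (K : Matrix n n ℂ) :
    ∀ᶠ η : ℝ in nhdsWithin 0 (Set.Ioi 0), IsUnit (K + η • (1 : Matrix n n ℂ)) := by
  have hp : (-K).charpoly ≠ 0 := (charpoly_monic (-K)).ne_zero
  have hfin : {η : ℝ | (-K).charpoly.IsRoot (η : ℂ)}.Finite :=
    (Polynomial.finite_setOfPred_isRoot hp).preimage Complex.ofReal_injective.injOn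
  have hfin2 : ({η : ℝ | (-K).charpoly.IsRoot (η : ℂ)} \ {0}).Finite := hfin.subset Set.sdiff_subset
  have hev : ∀ᶠ η : ℝ in nhds 0, η ∈ ({η : ℝ | (-K).charpoly.IsRoot (η : ℂ)} \ {0})ᶜ :=
    hfin2.isClosed.isOpen_compl.mem_nhds (by simp)
  filter_upwards [hev.filter_mono nhdsWithin_le_nhds, self_mem_nhdsWithin] with η h1 h2
  rw [Matrix.isUnit_iff_isUnit_det, isUnit_iff_ne_zero]
  intro hdet
  apply h1
  refine ⟨?_, (ne_of_gt h2)⟩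
  show (-K).charpoly.eval (η : ℂ) = 0
  rw [eval_charpoly, ← hdet]
  congr 1
  ext i j
  by_cases h : i = j
  · subst h; simp [add_comm]
  · simp [h]

lemma reg_bound [DecidableEq A] [DecidableEq B] [Nonempty A] [Nonempty B] [Nonempty n]
    {μX : X → ℝ} {μY : Y → ℝ}
    (hμX0 : ∀ x, 0 ≤ μX x) (hμX1 : ∑ x : X, μX x = 1)
    (hμY0 : ∀ y, 0 ≤ μY y) (hμY1 : ∑ y : Y, μY y = 1)
    (V : X → Y → A → B → Bool) {ε : ℝ} (hε0 : 0 < ε) (hε1 : ε ≤ 1)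
    (hAB : 2 ≤ Fintype.card A * Fintype.card B)
    (hG : ∀ (K : Matrix n n ℂ) (P : X → A → Matrix n n ℂ) (R : Y → B → Matrix n n ℂ),
      (∀ x a, (P x a).PosSemidef) → (∀ x, ∑ a, P x a = 1) →
      (∀ y b, (R y b).PosSemidef) → (∀ y, ∑ b, R y b = 1) → win μX μY V K P R ≤ (1 - ε) * fn K)
    (K : Matrix n n ℂ)
    {Al : (ι → X) → (ι → A) → Matrix n n ℂ} {Bo : (ι → Y) → (ι → B) → Matrix n n ℂ}
    (hA : ∀ x a, (Al x a).PosSemidef) (hA1 : ∀ x, ∑ a, Al x a = 1)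
    (hB : ∀ x a, (Bo x a).PosSemidef) (hB1 : ∀ x, ∑ a, Bo x a = 1) [Nonempty ι] :
    qC μX μY V K Al Bo Finset.univ ≤ (1 - ε / 2) ^ (ε ^ 2 * (Fintype.card ι : ℝ) /
        (12000 * (Real.logb 2 (Fintype.card A) + Real.logb 2 (Fintype.card B)))) * fn K := by
  set θ := (1 - ε / 2) ^ (ε ^ 2 * (Fintype.card ι : ℝ) /
        (12000 * (Real.logb 2 (Fintype.card A) + Real.logb 2 (Fintype.card B)))) with hθ
  let Alη : ℝ → (ι → X) → (ι → A) → Matrix n n ℂ := fun η x a =>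
    (1 - η) • Al x a + (η * (Fintype.card (ι → A) : ℝ)⁻¹) • (1 : Matrix n n ℂ)
  let Boη : ℝ → (ι → Y) → (ι → B) → Matrix n n ℂ := fun η x a =>
    (1 - η) • Bo x a + (η * (Fintype.card (ι → B) : ℝ)⁻¹) • (1 : Matrix n n ℂ)
  have cA : (0:ℝ) < Fintype.card (ι → A) := by exact_mod_cast Fintype.card_pos
  have cB : (0:ℝ) < Fintype.card (ι → B) := by exact_mod_cast Fintype.card_pos
  have hev : ∀ᶠ η : ℝ in nhdsWithin 0 (Set.Ioi 0),
      qC μX μY V (K + η • (1 : Matrix n n ℂ)) (Alη η) (Boη η) Finset.univ ≤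
        θ * fn (K + η • (1 : Matrix n n ℂ)) := by
    have h01 : ∀ᶠ η : ℝ in nhdsWithin 0 (Set.Ioi 0), η < 1 :=
      (eventually_lt_nhds one_pos).filter_mono nhdsWithin_le_nhds
    filter_upwards [unit_eventually K, self_mem_nhdsWithin, h01] with η hu hη hη1
    have hη : 0 < η := hη
    set L := K + η • (1 : Matrix n n ℂ)
    have hL0 : 0 < fn L := by
      rcases (fn_nonneg L).lt_or_eq with h | h
      · exact h
      · have := fn_eq_zero h.symm
        rw [this] at hu
        exact absurd hu not_isUnit_zero
    have hs : 0 < (Real.sqrt (fn L))⁻¹ := by positivity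
    have hu' : IsUnit ((Real.sqrt (fn L))⁻¹ • L) := by
      have := hu.smul (Units.mk0 _ hs.ne')
      simpa [Units.smul_def] using this
    have := iterate_bound (ι := ι) hμX0 hμX1 hμY0 hμY1 V hε0 hε1 hAB hG hu' (scale_one hL0)
      (Al := Alη η) (Bo := Boη η)
      (fun x a => ((PosDef.one (n := n) (R := ℂ)).smul (by positivity)).posSemidef_add
        ((hA x a).smul (by linarith)))
      (fun x => by
        simp only [Alη]
        rw [Finset.sum_add_distrib, ← Finset.smul_sum, hA1, Finset.sum_const, Finset.card_univ,
          ← Nat.cast_smul_eq_nsmul ℝ, smul_smul, ← add_smul]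
        have : 1 - η + (Fintype.card (ι → A) : ℝ) * (η * (Fintype.card (ι → A) : ℝ)⁻¹) = 1 := by
          field_simp; ring
        rw [this, one_smul])
      (fun x a => ((PosDef.one (n := n) (R := ℂ)).smul (by positivity)).posSemidef_add
        ((hB x a).smul (by linarith)))
      (fun x => by
        simp only [Boη]
        rw [Finset.sum_add_distrib, ← Finset.smul_sum, hB1, Finset.sum_const, Finset.card_univ,
          ← Nat.cast_smul_eq_nsmul ℝ, smul_smul, ← add_smul]
        have : 1 - η + (Fintype.card (ι → B) : ℝ) * (η * (Fintype.card (ι → B) : ℝ)⁻¹) = 1 := by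
          field_simp; ring
        rw [this, one_smul])
    rw [qC_smul_K, inv_pow, Real.sq_sqrt hL0.le, ← hθ] at this
    rw [inv_mul_le_iff₀ hL0] at this
    linarith
  have c1 : Continuous fun η : ℝ =>
      qC μX μY V (K + η • (1 : Matrix n n ℂ)) (Alη η) (Boη η) Finset.univ := by
    unfold qC tq rt
    simp only [Alη, Boη]
    fun_prop
  have c2 : Continuous fun η : ℝ => θ * fn (K + η • (1 : Matrix n n ℂ)) := by
    unfold fn rt
    fun_prop
  have t1 := (c1.tendsto 0).mono_left (nhdsWithin_le_nhds (s := Set.Ioi 0))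
  have t2 := (c2.tendsto 0).mono_left (nhdsWithin_le_nhds (s := Set.Ioi 0))
  have := le_of_tendsto_of_tendsto t1 t2 hev
  simpa [Alη, Boη] using this

end Sq

/-- matrix form of the expectation -/
lemma expect_eq {p q : Type} [Fintype p] [Fintype q] (K : Matrix p q ℂ) (P : Matrix p p ℂ)
    (R : Matrix q q ℂ) (ψ : p × q → ℂ) (hψ : ψ = fun r => K r.1 r.2) :
    star ψ ⬝ᵥ ((P ⊗ₖ R) *ᵥ ψ) = (Kᴴ * P * K * Rᵀ).trace := by
  have h1 : (P ⊗ₖ R) *ᵥ ψ = fun r => (P * K * Rᵀ) r.1 r.2 := by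
    funext r
    obtain ⟨i, j⟩ := r
    simp only [mulVec, dotProduct, Fintype.sum_prod_type, kroneckerMap_apply, hψ, mul_apply,
      transpose_apply, Finset.sum_mul]
    rw [Finset.sum_comm]
    exact Finset.sum_congr rfl fun _ _ => Finset.sum_congr rfl fun _ _ => by ring
  have e : Kᴴ * P * K * Rᵀ = Kᴴ * (P * K * Rᵀ) := by simp only [Matrix.mul_assoc]
  rw [h1, e]
  generalize P * K * Rᵀ = M
  simp only [dotProduct, trace, diag, mul_apply, Fintype.sum_prod_type, hψ, Pi.star_apply,
    conjTranspose_apply]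
  exact Finset.sum_comm

lemma winProb_le_one {G : Game X Y A B} (hμ0 : ∀ p, 0 ≤ G.μ p) (hμ1 : ∑ p : X × Y, G.μ p = 1)
    {dA dB : ℕ} {ψ : Fin dA × Fin dB → ℂ}
    {Al : X → A → Matrix (Fin dA) (Fin dA) ℂ} {Bo : Y → B → Matrix (Fin dB) (Fin dB) ℂ}
    (hψ : star ψ ⬝ᵥ ψ = 1) (hA : ∀ x a, (Al x a).PosSemidef) (hA1 : ∀ x, ∑ a : A, Al x a = 1)
    (hB : ∀ y b, (Bo y b).PosSemidef) (hB1 : ∀ y, ∑ b : B, Bo y b = 1) :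
    winProb G ψ Al Bo ≤ 1 := by
  have h1 : ∀ x y, ∑ a, ∑ b, (star ψ ⬝ᵥ ((Al x a ⊗ₖ Bo y b) *ᵥ ψ)).re = 1 := by
    intro x y
    have : ∑ a, ∑ b, (Al x a ⊗ₖ Bo y b) = 1 := by
      have e : ∀ a, ∑ b, (Al x a ⊗ₖ Bo y b) = Al x a ⊗ₖ (1 : Matrix (Fin dB) (Fin dB) ℂ) := by
        intro a
        rw [← hB1 y]
        ext i j
        simp [Matrix.sum_apply, kroneckerMap_apply, Finset.mul_sum]
      simp only [e]
      rw [← one_kronecker_one, ← hA1 x]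
      ext i j
      simp [Matrix.sum_apply, kroneckerMap_apply, Finset.sum_mul]
    simp only [← Complex.re_sum, ← dotProduct_sum, ← Matrix.sum_mulVec]
    rw [this, one_mulVec, hψ, Complex.one_re]
  have h0 : ∀ x y a b, 0 ≤ (star ψ ⬝ᵥ ((Al x a ⊗ₖ Bo y b) *ᵥ ψ)).re := by
    intro x y a b
    exact (Complex.le_def.1 (((hA x a).kronecker (hB y b)).dotProduct_mulVec_nonneg ψ)).1
  unfold winProb
  calc _ ≤ ∑ x, ∑ y, ∑ a, ∑ b, G.μ (x, y) * (star ψ ⬝ᵥ ((Al x a ⊗ₖ Bo y b) *ᵥ ψ)).re := by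
        refine Finset.sum_le_sum fun x _ => Finset.sum_le_sum fun y _ =>
          Finset.sum_le_sum fun a _ => Finset.sum_le_sum fun b _ => ?_
        refine mul_le_mul_of_nonneg_right ?_ (h0 x y a b)
        have := hμ0 (x, y)
        split_ifs <;> simp [this]
    _ = 1 := by
        simp only [← Finset.mul_sum, h1, mul_one]
        rw [← hμ1, Fintype.sum_prod_type]

lemma base_bound {G : Game X Y A B} (hμ0 : ∀ p, 0 ≤ G.μ p) (hμ1 : ∑ p : X × Y, G.μ p = 1)
    {μX : X → ℝ} {μY : Y → ℝ} (hprod : ∀ x y, G.μ (x, y) = μX x * μY y) {ε : ℝ}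
    (hval : entangledValue G ≤ 1 - ε) {d : ℕ}
    (K : Matrix (Fin d) (Fin d) ℂ) (P : X → A → Matrix (Fin d) (Fin d) ℂ)
    (R : Y → B → Matrix (Fin d) (Fin d) ℂ)
    (hP : ∀ x a, (P x a).PosSemidef) (hP1 : ∀ x, ∑ a, P x a = 1)
    (hR : ∀ y b, (R y b).PosSemidef) (hR1 : ∀ y, ∑ b, R y b = 1) :
    win μX μY G.V K P R ≤ (1 - ε) * fn K := by
  have hone : ∀ K : Matrix (Fin d) (Fin d) ℂ, fn K = 1 → win μX μY G.V K P R ≤ 1 - ε := by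
    intro K hK
    refine le_trans ?_ hval
    refine le_csSup ⟨1, ?_⟩ ?_
    · rintro p ⟨dA, dB, ψ, Al, Bo, h1, h2, h3, h4, h5, rfl⟩
      exact winProb_le_one hμ0 hμ1 h1 h2 h3 h4 h5
    · refine ⟨d, d, fun r => K r.1 r.2, P, fun y b => (R y b)ᵀ, ?_, hP, hP1,
        fun y b => (hR y b).transpose, fun y => ?_, ?_⟩
      · have := expect_eq K 1 1 (fun r => K r.1 r.2) rfl
        rw [one_kronecker_one, one_mulVec] at this
        rw [this]
        simp only [transpose_one, mul_one]
        have h2 : (Kᴴ * K).trace.im = 0 :=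
          (Complex.le_def.1 (posSemidef_conjTranspose_mul_self K).trace_nonneg).2.symm
        exact Complex.ext hK h2
      · rw [← transpose_sum, hR1, transpose_one]
      · unfold win winProb
        refine Finset.sum_congr rfl fun x _ => Finset.sum_congr rfl fun y _ => ?_
        rw [Finset.mul_sum]
        refine Finset.sum_congr rfl fun a _ => ?_
        rw [Finset.mul_sum]
        refine Finset.sum_congr rfl fun b _ => ?_
        rw [expect_eq K _ _ _ rfl, hprod, transpose_transpose]
        simp only [tq, rt]
        ring
  rcases (fn_nonneg K).lt_or_eq with h | h
  · have := hone _ (scale_one h)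
    rw [win_smul_K, inv_pow, Real.sq_sqrt h.le, inv_mul_le_iff₀ h] at this
    linarith
  · have := fn_eq_zero h.symm
    subst this
    rw [← h]
    simp [win, tq, rt]

/-- padding a POVM along an isometry -/
lemma pad {p m : Type} [Fintype p] [Fintype m] [DecidableEq p] [DecidableEq m]
    {J : Matrix m p ℂ} (hJ : Jᴴ * J = 1) [Nonempty A] {P : A → Matrix p p ℂ}
    (hP : ∀ a, (P a).PosSemidef) (hP1 : ∑ a, P a = 1) :
    ∃ Q : A → Matrix m m ℂ, (∀ a, (Q a).PosSemidef) ∧ ∑ a, Q a = 1 ∧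
      ∀ a, Jᴴ * Q a * J = P a := by
  classical
  obtain ⟨a0⟩ := ‹Nonempty A›
  have hproj : (1 - J * Jᴴ) = (1 - J * Jᴴ)ᴴ * (1 - J * Jᴴ) := by
    have : J * Jᴴ * (J * Jᴴ) = J * Jᴴ := by
      rw [Matrix.mul_assoc, ← Matrix.mul_assoc Jᴴ, hJ, Matrix.one_mul]
    simp only [conjTranspose_sub, conjTranspose_one, conjTranspose_mul,
      conjTranspose_conjTranspose, Matrix.mul_sub, Matrix.sub_mul, this, Matrix.one_mul,
      Matrix.mul_one]
    abel
  refine ⟨fun a => J * P a * Jᴴ + (if a = a0 then 1 - J * Jᴴ else 0), fun a => ?_, ?_, fun a => ?_⟩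
  · refine ((hP a).mul_mul_conjTranspose_same J).add ?_
    split_ifs
    · rw [hproj]; exact posSemidef_conjTranspose_mul_self _
    · exact PosSemidef.zero
  · rw [Finset.sum_add_distrib, ← Matrix.sum_mul, ← Matrix.mul_sum, hP1]
    simp
  · have h1 : Jᴴ * (J * P a * Jᴴ) * J = P a := by
      calc _ = (Jᴴ * J) * P a * (Jᴴ * J) := by simp only [Matrix.mul_assoc]
        _ = _ := by rw [hJ, Matrix.one_mul, Matrix.mul_one]
    have h2 : Jᴴ * (1 - J * Jᴴ) * J = 0 := by
      rw [Matrix.mul_sub, ← Matrix.mul_assoc, hJ, Matrix.one_mul, Matrix.mul_one, sub_self,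
        Matrix.zero_mul]
    rw [Matrix.mul_add, Matrix.add_mul, h1]
    split_ifs
    · rw [h2, add_zero]
    · simp

lemma isometry_of {p m : Type} [Fintype p] [Fintype m] [DecidableEq p] [DecidableEq m]
    {f : p → m} (hf : Function.Injective f) :
    ((1 : Matrix m m ℂ).submatrix id f)ᴴ * (1 : Matrix m m ℂ).submatrix id f = 1 := by
  ext i j
  simp [mul_apply, one_apply, hf.eq_iff]
  
end Reduce
/-! ### Assembly -/

section Assembly

lemma strategy_bound {X Y A B : Type} [Fintype X] [Fintype Y] [Fintype A] [Fintype B]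
    [Nonempty A] [Nonempty B] [DecidableEq A] [DecidableEq B]
    {G : Game X Y A B}
    (hμ0 : ∀ p, 0 ≤ G.μ p) (hμ1 : ∑ p : X × Y, G.μ p = 1)
    {μX : X → ℝ} {μY : Y → ℝ}
    (hμX0 : ∀ x, 0 ≤ μX x) (hμX1 : ∑ x : X, μX x = 1)
    (hμY0 : ∀ y, 0 ≤ μY y) (hμY1 : ∑ y : Y, μY y = 1)
    (hprod : ∀ x y, G.μ (x, y) = μX x * μY y)
    (hAB : 2 ≤ Fintype.card A * Fintype.card B)
    {ε : ℝ} (hε0 : 0 < ε) (hε1 : ε ≤ 1)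
    (hval : entangledValue G ≤ 1 - ε)
    {k : ℕ} (hk : 1 ≤ k) {dA dB : ℕ} {ψ : Fin dA × Fin dB → ℂ}
    {Al : (Fin k → X) → (Fin k → A) → Matrix (Fin dA) (Fin dA) ℂ}
    {Bo : (Fin k → Y) → (Fin k → B) → Matrix (Fin dB) (Fin dB) ℂ}
    (hψ : star ψ ⬝ᵥ ψ = 1) (hA : ∀ x a, (Al x a).PosSemidef) (hA1 : ∀ x, ∑ a, Al x a = 1)
    (hB : ∀ y b, (Bo y b).PosSemidef) (hB1 : ∀ y, ∑ b, Bo y b = 1) :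
    winProb (gamePow G k) ψ Al Bo ≤
      (1 - ε / 2) ^ (ε ^ 2 * (k : ℝ) /
        (12000 * (Real.logb 2 (Fintype.card A) + Real.logb 2 (Fintype.card B)))) := by
  let K0 : Matrix (Fin dA) (Fin dB) ℂ := fun i j => ψ (i, j)
  obtain ⟨J, hJ⟩ : ∃ J : Matrix (Fin (dA + dB)) (Fin dA) ℂ, Jᴴ * J = 1 :=
    ⟨_, isometry_of (Fin.castAdd_injective dA dB)⟩
  obtain ⟨L, hL⟩ : ∃ L : Matrix (Fin (dA + dB)) (Fin dB) ℂ, Lᴴ * L = 1 :=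
    ⟨_, isometry_of (Fin.natAdd_injective dB dA)⟩
  choose Al' hA' hA1' hAl using fun x => pad hJ (hA x) (hA1 x)
  choose Bo' hB' hB1' hBo using fun y => pad hL (P := fun b => (Bo y b)ᵀ)
    (fun b => (hB y b).transpose) (by rw [← transpose_sum, hB1, transpose_one])
  let K := J * K0 * Lᴴ
  have hne : Nonempty (Fin (dA + dB)) := by
    by_contra hcon
    rw [not_nonempty_iff] at hcon
    have : IsEmpty (Fin dA) := ⟨fun i => hcon.elim (Fin.castAdd dB i)⟩
    simp [dotProduct] at hψ
  have hKψ : ψ = fun r => K0 r.1 r.2 := rfl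
  have hfn : fn K = 1 := by
    have e := expect_eq K0 1 1 ψ hKψ
    rw [one_kronecker_one, one_mulVec, hψ, transpose_one, Matrix.mul_one, Matrix.mul_one] at e
    have e2 : Kᴴ * K = L * (K0ᴴ * K0 * Lᴴ) := by
      calc Kᴴ * K = L * (K0ᴴ * (Jᴴ * J) * K0 * Lᴴ) := by
            simp only [K, conjTranspose_mul, conjTranspose_conjTranspose, Matrix.mul_assoc]
        _ = _ := by rw [hJ, Matrix.mul_one]
    unfold fn rt
    rw [e2, trace_mul_comm, Matrix.mul_assoc, hL, Matrix.mul_one, ← e, Complex.one_re]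
  have htq : ∀ x y a b, (star ψ ⬝ᵥ ((Al x a ⊗ₖ Bo y b) *ᵥ ψ)).re = tq (Al' x a) (Bo' y b) K := by
    intro x y a b
    have e2 : Kᴴ * Al' x a * K * Bo' y b = L * (K0ᴴ * Al x a * K0 * Lᴴ * Bo' y b) := by
      calc _ = L * (K0ᴴ * (Jᴴ * Al' x a * J) * K0 * Lᴴ * Bo' y b) := by
            simp only [K, conjTranspose_mul, conjTranspose_conjTranspose, Matrix.mul_assoc]
        _ = _ := by rw [hAl]
    have e3 : K0ᴴ * Al x a * K0 * Lᴴ * Bo' y b * L = K0ᴴ * Al x a * K0 * (Bo y b)ᵀ := by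
      rw [← hBo]
      simp only [Matrix.mul_assoc]
    unfold tq rt
    rw [expect_eq K0 _ _ ψ hKψ, e2, trace_mul_comm L, e3]
  have hwin : winProb (gamePow G k) ψ Al Bo = qC μX μY G.V K Al' Bo' Finset.univ := by
    unfold winProb qC
    refine Finset.sum_congr rfl fun x _ => ?_
    rw [Finset.mul_sum]
    refine Finset.sum_congr rfl fun y _ => ?_
    simp only [Finset.mul_sum]
    refine Finset.sum_congr rfl fun a _ => Finset.sum_congr rfl fun b _ => ?_
    rw [htq]
    have e1 : (gamePow G k).μ (x, y) = wt μX x * wt μY y := by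
      simp only [gamePow, wt, hprod, Finset.prod_mul_distrib]
    have e2 : (if (gamePow G k).V x y a b = true then (1:ℝ) else 0) =
        vC G.V Finset.univ x y (res Finset.univ a) (res Finset.univ b) := by
      simp [gamePow, vC, res]
    rw [e1, e2]
    ring
  have : Nonempty (Fin k) := ⟨⟨0, hk⟩⟩
  have := reg_bound (ι := Fin k) hμX0 hμX1 hμY0 hμY1 G.V hε0 hε1 hAB
    (base_bound hμ0 hμ1 hprod hval) K hA' hA1' hB' hB1'
  rw [hfn, mul_one, Fintype.card_fin] at this
  rw [hwin]
  exact this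

end Assembly

/-- **Main Theorem, explicit constants.**
Let `G` be a two-player one-round game whose question distribution is a product
distribution `μ = μX ⊗ μY`, with `|A|·|B| ≥ 2`. If `ω*(G) ≤ 1 − ε` for some
`ε ∈ (0,1]`, then for every `k ≥ 1`,
`ω*(G^k) ≤ (1 − ε/2)^(ε²k / (12000(log₂|A| + log₂|B|)))`. -/
theorem parallel_repetition_explicit
    {X Y A B : Type} [Fintype X] [Fintype Y] [Fintype A] [Fintype B]
    [Nonempty X] [Nonempty Y] [Nonempty A] [Nonempty B]
    (G : Game X Y A B)
    (hμ0 : ∀ p, 0 ≤ G.μ p) (hμ1 : ∑ p : X × Y, G.μ p = 1)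
    (μX : X → ℝ) (μY : Y → ℝ)
    (hμX0 : ∀ x, 0 ≤ μX x) (hμX1 : ∑ x : X, μX x = 1)
    (hμY0 : ∀ y, 0 ≤ μY y) (hμY1 : ∑ y : Y, μY y = 1)
    (hprod : ∀ x y, G.μ (x, y) = μX x * μY y)
    (hAB : 2 ≤ Fintype.card A * Fintype.card B)
    (ε : ℝ) (hε0 : 0 < ε) (hε1 : ε ≤ 1)
    (hval : entangledValue G ≤ 1 - ε)
    (k : ℕ) (hk : 1 ≤ k) :
    entangledValue (gamePow G k) ≤
      (1 - ε / 2) ^ (ε ^ 2 * (k : ℝ) /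
        (12000 * (Real.logb 2 (Fintype.card A) + Real.logb 2 (Fintype.card B)))) := by
  classical
  have hε2 : (0:ℝ) ≤ 1 - ε / 2 := by linarith
  unfold entangledValue
  refine Real.sSup_le ?_ (Real.rpow_nonneg hε2 _)
  rintro p ⟨dA, dB, ψ, Al, Bo, h1, h2, h3, h4, h5, rfl⟩
  exact strategy_bound hμ0 hμ1 hμX0 hμX1 hμY0 hμY1 hprod hAB hε0 hε1 hval hk h1 h2 h3 h4 h5
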